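/- arXiv:2401.00485 — 3 statements merged into one kernel-verified Lean document; each statement's English description precedes it below -/
import Mathlib

section
/- Let A and B be complex unital Banach algebras with A semisimple, and let T : A → B be a surjective additive map with σ(Tx) = σ(x) for all x ∈ A. Then T maps square-zero elements in A to square-zero elements in B: if x ∈ A satisfies x² = 0, then (Tx)² = 0. -/
open Filter Topology

theorem norm_pow_two_pow_succ_lt {R : Type*} [SeminormedRing R] {x : R} {c : ℝ} {k : ℕ}
    (h : ‖x ^ 2 ^ k‖ < c ^ 2 ^ k) : ‖x ^ 2 ^ (k + 1)‖ < c ^ 2 ^ (k + 1) := by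
  rw [pow_succ 2 k, pow_mul, pow_mul, sq, sq]
  exact (norm_mul_le _ _).trans_lt (mul_self_lt_mul_self (norm_nonneg _) h)

section SpectralRadius

variable {A : Type*} [NormedRing A] [NormedAlgebra ℂ A]

/-- The spectral radius of an element of a complex Banach algebra, as a real number. -/
noncomputable def srad (x : A) : ℝ := (spectralRadius ℂ x).toReal

theorem srad_nonneg (x : A) : 0 ≤ srad x := ENNReal.toReal_nonneg

theorem srad_congr_of_spectrum_eq {B : Type*} [NormedRing B] [NormedAlgebra ℂ B] {x : A} {y : B}
    (h : spectrum ℂ x = spectrum ℂ y) : srad x = srad y := by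
  rw [srad, srad, spectralRadius, spectralRadius, h]

theorem srad_le_of_forall_mem_spectrum {x : A} {c : ℝ} (hc : 0 ≤ c)
    (h : ∀ z ∈ spectrum ℂ x, ‖z‖ ≤ c) : srad x ≤ c := by
  refine ENNReal.toReal_le_of_le_ofReal hc (iSup₂_le fun z hz => ?_)
  rw [← enorm_eq_nnnorm, ← ofReal_norm]
  exact ENNReal.ofReal_le_ofReal (h z hz)

variable [CompleteSpace A]

theorem spectralRadius_le_enorm (x : A) : spectralRadius ℂ x ≤ ‖x‖ₑ := by
  refine le_of_tendsto (spectrum.pow_nnnorm_pow_one_div_tendsto_nhds_spectralRadius x) ?_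
  filter_upwards [eventually_ge_atTop 1] with n hn
  have h1 : (‖x ^ n‖₊ : ENNReal) ≤ (‖x‖ₑ) ^ n := by
    rw [enorm_eq_nnnorm]
    exact_mod_cast nnnorm_pow_le' x hn
  calc (‖x ^ n‖₊ : ENNReal) ^ (1 / n : ℝ) ≤ ((‖x‖ₑ) ^ n) ^ (1 / n : ℝ) := by gcongr
    _ = ‖x‖ₑ := by rw [one_div, ENNReal.pow_rpow_inv_natCast (by omega)]

theorem spectralRadius_ne_top (x : A) : spectralRadius ℂ x ≠ ⊤ :=
  ((spectralRadius_le_enorm x).trans_lt enorm_lt_top).ne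

theorem srad_le_norm (x : A) : srad x ≤ ‖x‖ := by
  have := ENNReal.toReal_mono enorm_ne_top (spectralRadius_le_enorm x)
  simpa [srad] using this

theorem tendsto_srad (x : A) :
    Tendsto (fun n : ℕ => ‖x ^ n‖ ^ (1 / n : ℝ)) atTop (𝓝 (srad x)) := by
  have h := (ENNReal.tendsto_toReal (spectralRadius_ne_top x)).comp
    (spectrum.pow_norm_pow_one_div_tendsto_nhds_spectralRadius x)
  refine h.congr fun n => ?_
  simp only [Function.comp]
  exact ENNReal.toReal_ofReal (by positivity)

theorem norm_le_srad_of_mem_spectrum {x : A} {z : ℂ} (hz : z ∈ spectrum ℂ x) : ‖z‖ ≤ srad x := by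
  have : (‖z‖₊ : ENNReal) ≤ spectralRadius ℂ x := le_iSup₂ (α := ENNReal) z hz
  simpa [srad] using ENNReal.toReal_mono (spectralRadius_ne_top x) this

theorem srad_pow_le (x : A) {n : ℕ} (hn : n ≠ 0) : srad x ^ n ≤ srad (x ^ n) := by
  have := ENNReal.toReal_mono (spectralRadius_ne_top _) (spectrum.spectralRadius_pow_le x n hn)
  simpa [srad] using this

theorem srad_le_of_norm_pow_le {x : A} {n : ℕ} (hn : n ≠ 0) {c : ℝ} (hc : 0 ≤ c)
    (h : ‖x ^ n‖ ≤ c ^ n) : srad x ≤ c :=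
  le_of_pow_le_pow_left₀ hn hc (((srad_pow_le x hn).trans (srad_le_norm _)).trans h)

theorem srad_pow_le_norm_pow (x : A) {n : ℕ} (hn : n ≠ 0) : srad x ^ n ≤ ‖x ^ n‖ :=
  (srad_pow_le x hn).trans (srad_le_norm _)

theorem eventually_norm_pow_lt {x : A} {c : ℝ} (h : srad x < c) :
    ∀ᶠ n : ℕ in atTop, ‖x ^ n‖ < c ^ n := by
  have hc : 0 < c := (srad_nonneg x).trans_lt h
  filter_upwards [(tendsto_srad x).eventually_lt_const h, eventually_ge_atTop 1] with n hn h1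
  have h2 : (‖x ^ n‖ ^ (1 / n : ℝ)) ^ n = ‖x ^ n‖ := by
    rw [one_div, Real.rpow_inv_natCast_pow (norm_nonneg _) (by omega)]
  rw [← h2]
  exact pow_lt_pow_left₀ hn (by positivity) (by omega)

theorem srad_pow (x : A) {n : ℕ} (hn : n ≠ 0) : srad (x ^ n) = srad x ^ n := by
  refine le_antisymm ?_ (srad_pow_le x hn)
  refine le_of_forall_gt_imp_ge_of_dense fun d hd => ?_
  have hd0 : 0 ≤ d := (pow_nonneg (srad_nonneg x) n).trans hd.le
  have h1 : srad x < d ^ (1 / n : ℝ) := by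
    rw [one_div, Real.lt_rpow_inv_iff_of_pos (srad_nonneg x) hd0 (by positivity)]
    simpa using hd
  obtain ⟨m, hm, hm1⟩ :=
    ((((tendsto_id.nsmul_atTop (Nat.pos_of_ne_zero hn)).eventually
      (eventually_norm_pow_lt h1))).and (eventually_ge_atTop 1)).exists
  refine srad_le_of_norm_pow_le (n := m) (by omega) hd0 ?_
  rw [← pow_mul]
  simp only [id, smul_eq_mul] at hm
  refine hm.le.trans_eq ?_
  rw [pow_mul, one_div, Real.rpow_inv_natCast_pow hd0 hn]

theorem eventually_srad_lt {x : A} {c : ℝ} (h : srad x < c) : ∀ᶠ y in 𝓝 x, srad y < c := by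
  obtain ⟨d, hd, hdc⟩ := exists_between h
  obtain ⟨n, hn, h1⟩ := ((eventually_norm_pow_lt hd).and (eventually_ge_atTop 1)).exists
  have hcont : Continuous fun y : A => ‖y ^ n‖ := by fun_prop
  filter_upwards [hcont.continuousAt.eventually_lt_const hn] with y hy
  exact (srad_le_of_norm_pow_le (by omega) ((srad_nonneg x).trans hd.le) hy.le).trans_lt hdc

theorem srad_smul (w : ℂ) (x : A) : srad (w • x) = ‖w‖ * srad x := by
  refine tendsto_nhds_unique (tendsto_srad _) (((tendsto_srad x).const_mul ‖w‖).congr' ?_)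
  filter_upwards [eventually_ge_atTop 1] with n hn
  rw [smul_pow, norm_smul, Real.mul_rpow (by positivity) (by positivity), norm_pow w, one_div,
    Real.pow_rpow_inv_natCast (norm_nonneg w) (by omega)]

theorem isUnit_one_sub_of_srad_lt_one {x : A} (h : srad x < 1) : IsUnit (1 - x) := by
  have : (1 : ℂ) ∉ spectrum ℂ x := fun h1 => by
    have := norm_le_srad_of_mem_spectrum h1
    simp at this
    linarith
  simpa [spectrum.mem_iff] using this

theorem isUnit_one_add_of_srad_lt_one {x : A} (h : srad x < 1) : IsUnit (1 + x) := by
  have := isUnit_one_sub_of_srad_lt_one (x := (-1 : ℂ) • x) (by rw [srad_smul]; simpa using h)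
  simpa using this

theorem exists_norm_pow_lt_on_compact {X : Type*} [TopologicalSpace X] {K : Set X}
    (hK : IsCompact K) {f : X → A} (hf : ContinuousOn f K) {c : ℝ} (h : ∀ z ∈ K, srad (f z) < c) :
    ∃ n ≠ 0, ∀ z ∈ K, ‖f z ^ n‖ < c ^ n := by
  suffices H : ∃ k0 : ℕ, ∀ k ≥ k0, ∀ z ∈ K, ‖f z ^ 2 ^ k‖ < c ^ 2 ^ k by
    obtain ⟨k, hk⟩ := H
    exact ⟨2 ^ k, by positivity, hk k le_rfl⟩
  refine hK.induction_on (p := fun s => ∃ k0 : ℕ, ∀ k ≥ k0, ∀ z ∈ s, ‖f z ^ 2 ^ k‖ < c ^ 2 ^ k)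
    ⟨0, by simp⟩ ?_ ?_ ?_
  · rintro s t hst ⟨k, hk⟩
    exact ⟨k, fun j hj z hz => hk j hj z (hst hz)⟩
  · rintro s t ⟨k, hk⟩ ⟨l, hl⟩
    refine ⟨max k l, fun j hj z hz => ?_⟩
    rcases hz with hz | hz
    · exact hk j (le_of_max_le_left hj) z hz
    · exact hl j (le_of_max_le_right hj) z hz
  · intro z hz
    obtain ⟨n, hn⟩ := ((tendsto_pow_atTop_atTop_of_one_lt (one_lt_two (α := ℕ))).eventually
      (eventually_norm_pow_lt (h z hz))).exists
    have hc : ContinuousWithinAt (fun y => ‖f y ^ 2 ^ n‖) K z := ((hf z hz).pow _).norm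
    refine ⟨_, hc.eventually_lt_const hn, n, fun j hj y hy => ?_⟩
    induction j, hj using Nat.le_induction with
    | base => exact hy
    | succ j _ ih => exact norm_pow_two_pow_succ_lt ih

/-- Maximum principle for the spectral radius of a holomorphic function. -/
theorem srad_le_of_forall_mem_frontier {U : Set ℂ} (hU : Bornology.IsBounded U) {f : ℂ → A}
    (hf : DiffContOnCl ℂ f U) {C : ℝ} (hC : ∀ z ∈ frontier U, srad (f z) ≤ C) {z : ℂ}
    (hz : z ∈ closure U) (hC0 : 0 ≤ C) : srad (f z) ≤ C := by
  refine le_of_forall_gt_imp_ge_of_dense fun d hd => ?_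
  have hK : IsCompact (frontier U) := Metric.isCompact_of_isClosed_isBounded isClosed_frontier
    (hU.closure.subset frontier_subset_closure)
  obtain ⟨n, hn, h⟩ := exists_norm_pow_lt_on_compact hK
    (hf.continuousOn.mono frontier_subset_closure) (fun z hz => (hC z hz).trans_lt hd)
  refine srad_le_of_norm_pow_le hn (hC0.trans hd.le) ?_
  have hfn : DiffContOnCl ℂ (fun z => f z ^ n) U :=
    ⟨hf.differentiableOn.pow n, hf.continuousOn.pow n⟩
  exact Complex.norm_le_of_forall_mem_frontier_norm_le hU hfn (fun z hz => (h z hz).le) hz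

end SpectralRadius

theorem norm_one_sub_inv_le {R : Type*} [NormedRing R] {e : R} (he : ‖e‖ ≤ 1 / 2) {u : Rˣ}
    (hu : (u : R) = 1 + e) : ‖1 - ((u⁻¹ : Rˣ) : R)‖ ≤ 2 * ‖e‖ := by
  set k : R := 1 - (u⁻¹ : Rˣ) with hk
  have hke : k = e - e * k := by
    have h : (1 + e) * (u⁻¹ : Rˣ) = 1 := by rw [← hu, Units.mul_inv]
    rw [add_mul, one_mul] at h
    rw [hk, mul_sub, mul_one, sub_sub_cancel, ← h, add_sub_cancel_left]
  have h1 : ‖k‖ ≤ ‖e‖ + ‖e‖ * ‖k‖ := by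
    calc ‖k‖ = ‖e - e * k‖ := by rw [← hke]
      _ ≤ ‖e‖ + ‖e * k‖ := norm_sub_le _ _
      _ ≤ ‖e‖ + ‖e‖ * ‖k‖ := by gcongr; exact norm_mul_le _ _
  nlinarith [norm_nonneg k]

section Radical

theorem mem_jacobson_bot_of_forall_isUnit {R : Type*} [Ring R] {c : R}
    (h : ∀ y : R, IsUnit (1 + y * c)) : c ∈ Ideal.jacobson (⊥ : Ideal R) := by
  refine Ideal.mem_jacobson_iff.2 fun y => ?_
  obtain ⟨u, hu⟩ := h y
  refine ⟨(u⁻¹ : Rˣ), ?_⟩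
  have : (u⁻¹ : Rˣ) * (1 + y * c) = 1 := by rw [← hu, Units.inv_mul]
  rw [Ideal.mem_bot, ← this]
  noncomm_ring

variable {A : Type*} [NormedRing A] [NormedAlgebra ℂ A] [CompleteSpace A]

theorem exists_ne_zero_isUnit_sub (y : A) : ∃ s : ℂ, s ≠ 0 ∧ IsUnit (y - algebraMap ℂ A s) := by
  have hn : ‖((‖y‖ + 1 : ℝ) : ℂ)‖ = ‖y‖ + 1 := by
    rw [Complex.norm_real, Real.norm_of_nonneg (by positivity)]
  refine ⟨((‖y‖ + 1 : ℝ) : ℂ), fun h => ?_, ?_⟩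
  · rw [h, norm_zero] at hn
    linarith [norm_nonneg y]
  · by_contra h
    have h1 : ((‖y‖ + 1 : ℝ) : ℂ) ∈ spectrum ℂ y := by
      rw [spectrum.mem_iff]
      rwa [← IsUnit.neg_iff, neg_sub] at h
    have := (norm_le_srad_of_mem_spectrum h1).trans (srad_le_norm y)
    linarith

/-- An element whose addition preserves invertibility lies in the Jacobson radical. -/
theorem mem_jacobson_bot_of_forall_isUnit_add {c : A} (h : ∀ u : A, IsUnit u → IsUnit (u + c)) :
    c ∈ Ideal.jacobson (⊥ : Ideal A) := by
  have hmul : ∀ u v : A, IsUnit u → IsUnit v → IsUnit (v + u * c) := by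
    rintro _ v ⟨u, rfl⟩ hv
    have h1 := u.isUnit.mul (h ((u⁻¹ : Aˣ) * v) ((u⁻¹).isUnit.mul hv))
    rwa [mul_add, Units.mul_inv_cancel_left] at h1
  refine mem_jacobson_bot_of_forall_isUnit fun y => ?_
  obtain ⟨s, hs, hys⟩ := exists_ne_zero_isUnit_sub y
  have hs1 : IsUnit (algebraMap ℂ A s) := (IsUnit.mk0 s hs).map _
  have := hmul _ _ hs1 (hmul _ _ hys isUnit_one)
  rwa [add_assoc, ← add_mul, sub_add_cancel] at this

end Radical

section Liouville

variable {B : Type*} [NormedRing B] [NormedAlgebra ℂ B] [CompleteSpace B]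

theorem frontier_ball_diff_closedBall_subset (c : ℂ) (R ε : ℝ) :
    frontier (Metric.ball c R \ Metric.closedBall c ε) ⊆ Metric.sphere c R ∪ Metric.sphere c ε := by
  rw [Set.sdiff_eq]
  refine (frontier_inter_subset _ _).trans (Set.union_subset_union ?_ ?_)
  · exact Set.inter_subset_left.trans Metric.frontier_ball_subset_sphere
  · rw [frontier_compl]
    exact Set.inter_subset_right.trans Metric.frontier_closedBall_subset_sphere

theorem le_of_forall_pow_le_mul_pow {x y K : ℝ} (hy : 0 < y)
    (h : ∀ m : ℕ, m ≠ 0 → x ^ m ≤ K * y ^ m) : x ≤ y := by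
  by_contra! hlt
  obtain ⟨n, hn⟩ := pow_unbounded_of_one_lt K ((one_lt_div hy).2 hlt)
  have h1 : K < (x / y) ^ (n + 1) := by
    rw [pow_succ]
    have := (one_lt_div hy).2 hlt
    nlinarith [pow_pos (zero_lt_one.trans this) n]
  rw [div_pow, lt_div_iff₀ (pow_pos hy _)] at h1
  exact h1.not_ge (h _ n.succ_ne_zero)

/-- Liouville theorem for the spectral radius of an entire function. -/
theorem srad_le_srad_of_bounded {F : ℂ → B} (hF : Differentiable ℂ F) {C R₀ : ℝ}
    (hC : ∀ ζ : ℂ, R₀ ≤ ‖ζ‖ → srad (F ζ) ≤ C) (z μ : ℂ) : srad (F z) ≤ srad (F μ) := by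
  rcases eq_or_ne z μ with rfl | hne
  · exact le_rfl
  refine le_of_forall_gt_imp_ge_of_dense fun ρ hρ => ?_
  have hρ0 : 0 < ρ := (srad_nonneg _).trans_lt hρ
  have hzμ : 0 < ‖z - μ‖ := norm_pos_iff.2 (sub_ne_zero.2 hne)
  obtain ⟨ε₁, hε₁, hb⟩ := Metric.eventually_nhds_iff.1
    (hF.continuous.continuousAt.eventually (eventually_srad_lt hρ))
  obtain ⟨ε, hε, hεlt⟩ : ∃ ε > 0, ε < min ε₁ ‖z - μ‖ := exists_between (lt_min hε₁ hzμ)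
  refine le_of_forall_pow_le_mul_pow (K := ‖z - μ‖ * ε⁻¹) hρ0 fun m hm => ?_
  have hlim : Tendsto (fun R : ℝ => R⁻¹ * C ^ m) atTop (𝓝 0) := by
    simpa using tendsto_inv_atTop_zero.mul_const (C ^ m)
  obtain ⟨R, hR1, hR2, hR3⟩ := ((hlim.eventually_lt_const
    (show 0 < ε⁻¹ * ρ ^ m by positivity)).and
    ((eventually_ge_atTop (R₀ + ‖μ‖)).and (eventually_gt_atTop ‖z - μ‖))).exists
  have hεz : ε < ‖z - μ‖ := hεlt.trans_le (min_le_right _ _)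
  have key : srad ((z - μ)⁻¹ • F z ^ m) ≤ ε⁻¹ * ρ ^ m := by
    refine srad_le_of_forall_mem_frontier (f := fun ζ => (ζ - μ)⁻¹ • F ζ ^ m)
      (U := Metric.ball μ R \ Metric.closedBall μ ε)
      (Metric.isBounded_ball.subset Set.sdiff_subset) ?_ ?_ (subset_closure ?_) (by positivity)
    · refine DifferentiableOn.diffContOnCl fun ζ hζ => DifferentiableAt.differentiableWithinAt ?_
      have hζ' : ζ - μ ≠ 0 := by
        have h1 : Metric.ball μ R \ Metric.closedBall μ ε ⊆ (Metric.ball μ ε)ᶜ :=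
          fun x hx hx' => hx.2 (Metric.ball_subset_closedBall hx')
        have h2 := closure_minimal h1 Metric.isOpen_ball.isClosed_compl hζ
        rintro h0
        rw [sub_eq_zero] at h0
        exact h2 (by simpa [h0] using hε)
      exact ((differentiableAt_id.sub_const μ).inv hζ').smul ((hF ζ).pow m)
    · intro ζ hζ
      rw [srad_smul, srad_pow _ hm, norm_inv]
      rcases frontier_ball_diff_closedBall_subset μ R ε hζ with h | h
      · rw [mem_sphere_iff_norm] at h
        rw [h]
        have h3 : R₀ ≤ ‖ζ‖ := by
          have := norm_sub_le ζ μ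
          linarith
        have : 0 < R := hzμ.trans hR3
        refine le_trans ?_ hR1.le
        have := pow_le_pow_left₀ (srad_nonneg _) (hC ζ h3) m
        gcongr
      · rw [mem_sphere_iff_norm] at h
        rw [h]
        have h4 := hb (y := ζ) (by rw [dist_eq_norm, h]; exact hεlt.trans_le (min_le_left _ _))
        have := pow_le_pow_left₀ (srad_nonneg _) h4.le m
        gcongr
    · simp [dist_eq_norm, hR3, hεz]
  rw [srad_smul, srad_pow _ hm, norm_inv, inv_mul_le_iff₀ hzμ] at key
  linarith

/-- If `w - a - h` is invertible whenever `‖h‖` is small compared with `‖w‖ ^ 2`, then every left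
multiple of `a * a` is quasinilpotent. -/
theorem srad_mul_mul_self_eq_zero {a : B} {K : ℝ} (hK : 0 ≤ K)
    (hcontact : ∀ (h : B) (w : ℂ), ‖h‖ ≤ 1 → K * ‖h‖ < ‖w‖ ^ 2 →
      IsUnit (algebraMap ℂ B w - a - h)) (b : B) : srad (b * (a * a)) = 0 := by
  have hunit : ∀ ζ : ℂ, IsUnit (1 - ζ • a) := by
    intro ζ
    rcases eq_or_ne ζ 0 with rfl | hζ
    · simp
    have h1 := hcontact 0 ζ⁻¹ (by simp) (by
      have := norm_pos_iff.2 (inv_ne_zero hζ)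
      simp only [norm_zero, mul_zero]
      positivity)
    have h2 := ((IsUnit.mk0 ζ hζ).map (algebraMap ℂ B)).mul h1
    simpa [mul_sub, ← map_mul, hζ, ← Algebra.smul_def] using h2
  set R : ℂ → B := fun ζ => Ring.inverse (1 - ζ • a) with hRdef
  have hRdiff : Differentiable ℂ R := fun ζ =>
    DifferentiableAt.comp (g := Ring.inverse) (f := fun ζ : ℂ => 1 - ζ • a) ζ
      (differentiableAt_inverse (hunit ζ)) (by fun_prop)
  have hkey : ∀ b : B, ∃ C : ℝ, ∀ ζ : ℂ, 1 ≤ ‖ζ‖ → srad (b * a * R ζ) ≤ C := by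
    intro b
    refine ⟨2 * (K + 1) * ‖b‖ + 1, fun ζ hζ => srad_le_of_forall_mem_spectrum (by positivity)
      fun z hz => ?_⟩
    by_contra! hlt
    have hz0 : 0 < ‖z‖ := lt_trans (by positivity) hlt
    have hζ0 : ζ ≠ 0 := norm_pos_iff.1 (by linarith)
    have hz0' : z ≠ 0 := norm_pos_iff.1 hz0
    set e : B := (z⁻¹ * ζ⁻¹) • b with he
    have hbz : 2 * (K + 1) * (‖z‖⁻¹ * ‖b‖) < 1 := by
      rw [← mul_assoc, mul_comm _ (‖z‖⁻¹), mul_assoc, inv_mul_lt_iff₀ hz0]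
      linarith
    have hbz0 : 0 ≤ ‖z‖⁻¹ * ‖b‖ := by positivity
    have hζinv : ‖ζ‖⁻¹ ≤ 1 := inv_le_one_of_one_le₀ hζ
    have hζinv0 : 0 < ‖ζ‖⁻¹ := by positivity
    have hen : ‖e‖ = ‖z‖⁻¹ * ‖b‖ * ‖ζ‖⁻¹ := by
      rw [he, norm_smul, norm_mul, norm_inv, norm_inv]
      ring
    have he1 : ‖e‖ ≤ 1 / 2 := by
      rw [hen]
      nlinarith
    obtain ⟨u, hu⟩ := isUnit_one_add_of_srad_lt_one ((srad_le_norm e).trans_lt (by linarith))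
    set k : B := 1 - (u⁻¹ : Bˣ) with hk
    have hkn : ‖k‖ ≤ 2 * ‖e‖ := norm_one_sub_inv_le he1 hu
    have hhn : ‖ζ⁻¹ • k‖ ≤ 2 * (‖z‖⁻¹ * ‖b‖) * ‖ζ⁻¹‖ ^ 2 := by
      rw [norm_smul, norm_inv]
      rw [hen] at hkn
      nlinarith
    have hsq : ‖ζ⁻¹‖ ^ 2 ≤ 1 := by
      rw [norm_inv]
      exact pow_le_one₀ hζinv0.le hζinv
    have hsq0 : 0 < ‖ζ⁻¹‖ ^ 2 := by
      rw [norm_inv]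
      positivity
    have h1 := hcontact (ζ⁻¹ • k) ζ⁻¹ (hhn.trans (by nlinarith)) (by
      refine (mul_le_mul_of_nonneg_left hhn hK).trans_lt ?_
      nlinarith)
    have h2 := ((IsUnit.mk0 ζ hζ0).map (algebraMap ℂ B)).mul h1
    have h3 := u.isUnit.mul h2
    have h4 : (u : B) * (algebraMap ℂ B ζ * (algebraMap ℂ B ζ⁻¹ - a - ζ⁻¹ • k))
        = 1 - ζ • a - z⁻¹ • (b * a) := by
      have : algebraMap ℂ B ζ * (algebraMap ℂ B ζ⁻¹ - a - ζ⁻¹ • k) = (u⁻¹ : Bˣ) - ζ • a := by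
        rw [← Algebra.smul_def, smul_sub, smul_sub, smul_smul, mul_inv_cancel₀ hζ0, one_smul,
          Algebra.smul_def ζ (algebraMap ℂ B ζ⁻¹), ← map_mul, mul_inv_cancel₀ hζ0, map_one, hk]
        abel
      rw [this, mul_sub, Units.mul_inv, hu, add_mul, one_mul, he, smul_mul_assoc, mul_smul_comm,
        smul_smul, mul_assoc, inv_mul_cancel₀ hζ0, mul_one, sub_sub]
    rw [h4] at h3
    have h5 : IsUnit (R ζ) := (hunit ζ).ringInverse
    have h6 := ((IsUnit.mk0 z hz0').map (algebraMap ℂ B)).mul (h3.mul h5)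
    have h7 : algebraMap ℂ B z * ((1 - ζ • a - z⁻¹ • (b * a)) * R ζ)
        = algebraMap ℂ B z - b * a * R ζ := by
      rw [sub_mul, hRdef]
      simp only
      rw [Ring.mul_inverse_cancel _ (hunit ζ), mul_sub, mul_one, smul_mul_assoc,
        ← Algebra.smul_def z (z⁻¹ • _), smul_smul, mul_inv_cancel₀ hz0', one_smul]
    rw [h7] at h6
    exact spectrum.mem_iff.1 hz h6
  have hL : ∀ μ : ℂ, srad (b * a - μ • (b * (a * a))) ≤ srad (b * a) := by
    intro μ
    obtain ⟨C, hC⟩ := hkey (b * (1 - μ • a))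
    have h := srad_le_srad_of_bounded (F := fun ζ => b * (1 - μ • a) * a * R ζ)
      (by fun_prop) hC 0 μ
    have e1 : b * (1 - μ • a) * a * R 0 = b * a - μ • (b * (a * a)) := by
      simp [hRdef, mul_sub, sub_mul, mul_assoc]
    have e2 : b * (1 - μ • a) * a * R μ = b * a := by
      have : b * (1 - μ • a) * a = b * a * (1 - μ • a) := by
        simp [mul_sub, sub_mul, mul_assoc]
      rw [this, mul_assoc, Ring.mul_inverse_cancel _ (hunit μ), mul_one]
    simpa only [e1, e2] using h
  have hL2 : ∀ m : ℂ, m ≠ 0 → srad (b * (a * a) - m • (b * a)) ≤ ‖m‖ * srad (b * a) := by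
    intro m hm
    have : b * (a * a) - m • (b * a) = (-m) • (b * a - m⁻¹ • (b * (a * a))) := by
      rw [smul_sub, smul_smul, neg_mul, mul_inv_cancel₀ hm, neg_smul, neg_smul, one_smul]
      abel
    rw [this, srad_smul, norm_neg]
    exact mul_le_mul_of_nonneg_left (hL _) (norm_nonneg _)
  have hL3 : ∀ ε > 0, srad (b * (a * a)) ≤ ε * srad (b * a) := by
    intro ε hε
    have := srad_le_of_forall_mem_frontier (U := Metric.ball (0 : ℂ) ε) Metric.isBounded_ball
      (f := fun m => b * (a * a) - m • (b * a)) (C := ε * srad (b * a))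
      (Differentiable.diffContOnCl (by fun_prop)) ?_ (z := 0)
      (subset_closure (by simpa using hε)) (mul_nonneg hε.le (srad_nonneg _))
    · simpa using this
    · intro m hm
      have hm' := mem_sphere_zero_iff_norm.1 (Metric.frontier_ball_subset_sphere hm)
      have := hL2 m (norm_pos_iff.1 (by rw [hm']; exact hε))
      rwa [hm'] at this
  refine le_antisymm ?_ (srad_nonneg _)
  have hlim : Tendsto (fun ε : ℝ => ε * srad (b * a)) (𝓝[>] 0) (𝓝 0) := by
    have : Tendsto (fun ε : ℝ => ε * srad (b * a)) (𝓝 0) (𝓝 (0 * srad (b * a))) :=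
      (continuous_mul_const _).tendsto 0
    rw [zero_mul] at this
    exact this.mono_left nhdsWithin_le_nhds
  exact ge_of_tendsto hlim (eventually_nhdsWithin_of_forall hL3)

end Liouville

section Subharmonic

open MeasureTheory Real

theorem log_norm_le_circleAverage_log_norm {f : ℂ → ℂ} (hf : Differentiable ℂ f) (h0 : f 0 ≠ 0) :
    log ‖f 0‖ ≤ circleAverage (fun w => log ‖f w‖) 0 1 := by
  have ha : AnalyticOnNhd ℂ f (Metric.closedBall 0 |1|) := fun z _ => hf.analyticAt z
  rw [ha.circleAverage_log_norm one_ne_zero h0]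
  refine le_add_of_nonneg_left (finsum_nonneg fun u => ?_)
  by_cases hu : u ∈ Metric.closedBall (0 : ℂ) |1|
  · refine mul_nonneg (by exact_mod_cast MeromorphicOn.AnalyticOnNhd.divisor_nonneg ha u) ?_
    rcases eq_or_ne u 0 with rfl | hu0
    · simp
    · refine log_nonneg ?_
      rw [one_mul, zero_sub, norm_neg]
      exact (one_le_inv₀ (norm_pos_iff.2 hu0)).2 (by simpa using hu)
  · rw [Function.locallyFinsuppWithin.apply_eq_zero_of_notMem _ hu]
    simp

theorem log_norm_le_circleAverage_posLog_norm {E : Type*} [NormedAddCommGroup E] [NormedSpace ℂ E]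
    {g : ℂ → E} (hg : Differentiable ℂ g) (h0 : g 0 ≠ 0) :
    log ‖g 0‖ ≤ circleAverage (fun w => log⁺ ‖g w‖) 0 1 := by
  obtain ⟨φ, hφ, hφ0⟩ := exists_dual_vector ℂ (g 0) (norm_ne_zero_iff.2 h0)
  have hd : Differentiable ℂ fun w => φ (g w) := φ.differentiable.comp hg
  have h1 := log_norm_le_circleAverage_log_norm hd (by simpa [hφ0] using h0)
  have h2 : ‖φ (g 0)‖ = ‖g 0‖ := by simp [hφ0]
  rw [h2] at h1
  refine h1.trans (circleAverage_mono ?_ ?_ fun w _ => ?_)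
  · exact MeromorphicOn.circleIntegrable_log_norm fun z _ => (hd.analyticAt z).meromorphicAt
  · have := hg.continuous
    exact ContinuousOn.circleIntegrable' (by fun_prop)
  · calc log ‖φ (g w)‖ ≤ log⁺ ‖φ (g w)‖ := le_max_right _ _
      _ ≤ log⁺ ‖g w‖ := posLog_le_posLog (norm_nonneg _) (by simpa [hφ] using φ.le_opNorm (g w))

theorem inv_mul_posLog_norm_pow_le {R : Type*} [SeminormedRing R] (x : R) {n : ℕ} (hn : n ≠ 0) :
    (n : ℝ)⁻¹ * log⁺ ‖x ^ n‖ ≤ log⁺ ‖x‖ := by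
  rw [inv_mul_le_iff₀ (by positivity), ← posLog_pow]
  exact posLog_le_posLog (norm_nonneg _) (norm_pow_le' x (Nat.pos_of_ne_zero hn))

variable {A : Type*} [NormedRing A] [NormedAlgebra ℂ A] [CompleteSpace A]

theorem tendsto_posLog_srad (x : A) :
    Tendsto (fun n : ℕ => (n : ℝ)⁻¹ * log⁺ ‖x ^ n‖) atTop (𝓝 (log⁺ (srad x))) := by
  refine ((continuous_posLog.tendsto _).comp (tendsto_srad x)).congr' ?_
  filter_upwards [eventually_ge_atTop 1] with n hn
  have h : ‖x ^ n‖ = (‖x ^ n‖ ^ (1 / n : ℝ)) ^ n := by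
    rw [one_div, rpow_inv_natCast_pow (norm_nonneg _) (by omega)]
  have hn0 : (n : ℝ) ≠ 0 := by positivity
  conv_rhs => rw [h, posLog_pow, inv_mul_cancel_left₀ hn0]
  rfl

theorem measurable_posLog_srad {q : ℝ → A} (hq : Continuous q) :
    Measurable fun θ => log⁺ (srad (q θ)) :=
  measurable_of_tendsto_metrizable
    (f := fun (n : ℕ) (θ : ℝ) => (n : ℝ)⁻¹ * log⁺ ‖q θ ^ n‖)
    (fun n => (by fun_prop : Continuous fun θ => (n : ℝ)⁻¹ * log⁺ ‖q θ ^ n‖).measurable)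
    (tendsto_pi_nhds.2 fun θ => tendsto_posLog_srad (q θ))

/-- The submean value inequality for the positive part of the logarithm of the spectral radius. -/
theorem log_srad_le_circleAverage {q : ℂ → A} (hq : Differentiable ℂ q) (h0 : 0 < srad (q 0)) :
    log (srad (q 0)) ≤ circleAverage (fun w => log⁺ (srad (q w))) 0 1 := by
  have hqc := hq.continuous
  have hqθ : Continuous fun θ : ℝ => q (circleMap 0 1 θ) := by fun_prop
  have hlim : Tendsto (fun n : ℕ => circleAverage (fun w => (n : ℝ)⁻¹ * log⁺ ‖q w ^ n‖) 0 1) atTop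
      (𝓝 (circleAverage (fun w => log⁺ (srad (q w))) 0 1)) := by
    simp only [circleAverage_def]
    refine Tendsto.const_smul ?_ _
    refine intervalIntegral.tendsto_integral_filter_of_dominated_convergence
      (fun θ => log⁺ ‖q (circleMap 0 1 θ)‖) (Eventually.of_forall fun n => ?_) ?_ ?_ ?_
    · exact (by fun_prop : Continuous fun θ : ℝ =>
        (n : ℝ)⁻¹ * log⁺ ‖q (circleMap 0 1 θ) ^ n‖).aestronglyMeasurable
    · filter_upwards [eventually_ge_atTop 1] with n hn
      refine ae_of_all _ fun θ _ => ?_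
      rw [norm_of_nonneg (mul_nonneg (by positivity) posLog_nonneg)]
      exact inv_mul_posLog_norm_pow_le _ (by omega)
    · exact (by fun_prop : Continuous fun θ : ℝ =>
        log⁺ ‖q (circleMap 0 1 θ)‖).intervalIntegrable _ _
    · exact ae_of_all _ fun θ _ => tendsto_posLog_srad _
  refine ge_of_tendsto hlim ?_
  filter_upwards [eventually_ge_atTop 1] with n hn
  have hpos : 0 < srad (q 0) ^ n := pow_pos h0 n
  have hle := srad_pow_le_norm_pow (q 0) (n := n) (by omega)
  have h1 := log_norm_le_circleAverage_posLog_norm (g := fun w => q w ^ n) (hq.pow n)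
    (norm_pos_iff.1 (hpos.trans_le hle))
  have h2 : n * log (srad (q 0)) ≤ circleAverage (fun w => log⁺ ‖q w ^ n‖) 0 1 := by
    rw [← log_pow]
    exact (log_le_log hpos hle).trans h1
  have h3 := circleAverage_fun_smul (a := (n : ℝ)⁻¹) (f := fun w => log⁺ ‖q w ^ n‖)
    (c := (0 : ℂ)) (R := 1)
  simp only [smul_eq_mul] at h3
  rw [h3, le_inv_mul_iff₀ (by positivity)]
  exact h2

/-- A family of entire functions with a common value at the centre, whose spectral radii are
asymptotically at most that value on the unit circle and at most one on a fixed arc. -/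
theorem srad_le_one_of_asymptotic_bound {q : ℕ → ℂ → A} (hq : ∀ n, Differentiable ℂ (q n)) {Y : A}
    (hY : ∀ n, q n 0 = Y) {C : ℝ} (hC : ∀ n θ, srad (q n (circleMap 0 1 θ)) ≤ C)
    (hlim : ∀ θ : ℝ, ∀ d > srad Y, ∀ᶠ n in atTop, srad (q n (circleMap 0 1 θ)) < d)
    {κ : ℝ} (hκ : 0 < κ) (hκπ : κ < π)
    (harc : ∀ᶠ n in atTop, ∀ θ : ℝ, |θ - π| < κ → srad (q n (circleMap 0 1 θ)) ≤ 1) :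
    srad Y ≤ 1 := by
  by_contra! hlt
  set ℓ := log (srad Y)
  have hℓ0 : 0 < ℓ := log_pos hlt
  set u : ℕ → ℝ → ℝ := fun n θ => log⁺ (srad (q n (circleMap 0 1 θ))) with hu
  have hum : ∀ n, Measurable (u n) := fun n => by
    have := (hq n).continuous
    exact measurable_posLog_srad (q := fun θ => q n (circleMap 0 1 θ)) (by fun_prop)
  have huC : ∀ n θ, u n θ ≤ log⁺ C := fun n θ => posLog_le_posLog (srad_nonneg _) (hC n θ)
  have hu0 : ∀ n θ, 0 ≤ u n θ := fun n θ => posLog_nonneg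
  have hfin : ∀ {f : ℝ → ℝ}, Measurable f → ∀ M, (∀ θ, |f θ| ≤ M) →
      IntervalIntegrable f volume 0 (2 * π) := fun hf M hM =>
    (intervalIntegrable_const (c := M)).mono_fun' hf.aestronglyMeasurable (ae_of_all _ hM)
  have hmean : ∀ n, 2 * π * ℓ ≤ ∫ θ in 0..2 * π, u n θ := fun n => by
    have := log_srad_le_circleAverage (hq n) (by rw [hY]; linarith)
    rw [hY, circleAverage_def, smul_eq_mul, le_inv_mul_iff₀ (by positivity)] at this
    exact this
  set f : ℕ → ℝ → ℝ := fun n θ => max 0 (u n θ - ℓ)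
  have hfm : ∀ n, Measurable (f n) := fun n => measurable_const.max ((hum n).sub_const _)
  have hfb : ∀ n θ, |f n θ| ≤ log⁺ C := fun n θ => by
    rw [abs_of_nonneg (le_max_left _ _)]
    exact max_le posLog_nonneg (by linarith [huC n θ])
  have hf0 : Tendsto (fun n => ∫ θ in 0..2 * π, f n θ) atTop (𝓝 (∫ θ in 0..2 * π, (0 : ℝ))) := by
    refine intervalIntegral.tendsto_integral_filter_of_dominated_convergence (fun _ => log⁺ C)
      (Eventually.of_forall fun n => (hfm n).aestronglyMeasurable)
      (Eventually.of_forall fun n => ae_of_all _ fun θ _ => hfb n θ)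
      intervalIntegrable_const (ae_of_all _ fun θ _ => ?_)
    refine tendsto_order.2 ⟨fun a ha => Eventually.of_forall fun n =>
      ha.trans_le (le_max_left _ _), fun a ha => ?_⟩
    have hd : srad Y < exp (ℓ + a) := by
      rw [← log_lt_iff_lt_exp (by linarith)]
      linarith
    filter_upwards [hlim θ _ hd] with n hn
    refine max_lt ha ?_
    have : u n θ < ℓ + a := by
      refine max_lt (by linarith) ?_
      rcases (srad_nonneg (q n (circleMap 0 1 θ))).eq_or_lt with h | h
      · rw [← h, log_zero]
        linarith
      · rwa [log_lt_iff_lt_exp h]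
    linarith
  rw [intervalIntegral.integral_zero] at hf0
  obtain ⟨n, hn, hn2⟩ := ((hf0.eventually_lt_const (show 0 < 2 * κ * ℓ by positivity)).and
    harc).exists
  set s : Set ℝ := Set.Ioo (π - κ) (π + κ)
  have hgm : Measurable (s.indicator fun _ : ℝ => ℓ) := measurable_const.indicator measurableSet_Ioo
  have hle : ∀ θ, u n θ ≤ f n θ + (ℓ - s.indicator (fun _ => ℓ) θ) := by
    intro θ
    by_cases hθ : θ ∈ s
    · have h1 := hn2 θ (abs_lt.2 ⟨by linarith [hθ.1], by linarith [hθ.2]⟩)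
      have h2 : u n θ = 0 := by
        rw [hu]
        simp only
        rw [posLog_eq_zero_iff, abs_of_nonneg (srad_nonneg _)]
        exact h1
      rw [Set.indicator_of_mem hθ, h2]
      rw [sub_self, add_zero]
      exact le_max_left _ _
    · rw [Set.indicator_of_notMem hθ]
      have : u n θ - ℓ ≤ f n θ := le_max_right _ _
      linarith
  have hind : ∀ θ, |s.indicator (fun _ => ℓ) θ| ≤ ℓ := fun θ => by
    by_cases hθ : θ ∈ s
    · rw [Set.indicator_of_mem hθ, abs_of_pos hℓ0]
    · rw [Set.indicator_of_notMem hθ, abs_zero]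
      exact hℓ0.le
  have hii := hfin hgm ℓ hind
  have hmono := intervalIntegral.integral_mono (show (0 : ℝ) ≤ 2 * π by positivity)
    (hfin (hum n) (log⁺ C) fun θ => by rw [abs_of_nonneg (hu0 n θ)]; exact huC n θ)
    ((hfin (hfm n) _ (hfb n)).add (intervalIntegrable_const.sub hii)) hle
  have hval : ∫ θ in 0..2 * π, s.indicator (fun _ => ℓ) θ = 2 * κ * ℓ := by
    rw [intervalIntegral.integral_of_le (by positivity), setIntegral_indicator measurableSet_Ioo,
      Set.inter_eq_self_of_subset_right, setIntegral_const, smul_eq_mul, Real.volume_real_Ioo_of_le]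
    · ring
    · linarith
    · exact fun θ hθ => ⟨by linarith [hθ.1], by linarith [hθ.2]⟩
  rw [intervalIntegral.integral_add (hfin (hfm n) _ (hfb n)) (intervalIntegrable_const.sub hii),
    intervalIntegral.integral_sub intervalIntegrable_const hii, hval,
    intervalIntegral.integral_const, smul_eq_mul] at hmono
  have := hmean n
  linarith

end Subharmonic

section ClosedGraph

variable {A : Type*} [NormedRing A] [NormedAlgebra ℂ A]

theorem srad_eq_zero_of_forall_isUnit {x : A} (h : ∀ μ : ℂ, IsUnit (1 + μ • x)) : srad x = 0 := by
  refine le_antisymm (srad_le_of_forall_mem_spectrum le_rfl fun z hz => ?_) (srad_nonneg x)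
  by_contra! hz0
  have hz0 : z ≠ 0 := norm_pos_iff.1 hz0
  have h1 := ((IsUnit.mk0 z hz0).map (algebraMap ℂ A)).mul (h (-z⁻¹))
  rw [← Algebra.smul_def, smul_add, smul_smul, mul_neg, mul_inv_cancel₀ hz0, neg_smul, one_smul,
    ← sub_eq_add_neg, ← Algebra.algebraMap_eq_smul_one] at h1
  exact spectrum.mem_iff.1 hz h1

variable [CompleteSpace A]

/-- An element which does not increase spectral radii by addition lies in the Jacobson radical. -/
theorem mem_jacobson_bot_of_srad_add_le {x : A} (hx : ∀ y : A, srad (y + x) ≤ srad y) :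
    x ∈ Ideal.jacobson (⊥ : Ideal A) := by
  have hx' : ∀ (h : A) (μ : ℂ), srad (h + μ • x) ≤ srad h := by
    intro h μ
    rcases eq_or_ne μ 0 with rfl | hμ
    · simp
    have e1 : h + μ • x = μ • (μ⁻¹ • h + x) := by
      rw [smul_add, smul_smul, mul_inv_cancel₀ hμ, one_smul]
    have e2 : srad (μ⁻¹ • h) = ‖μ‖⁻¹ * srad h := by rw [srad_smul, norm_inv]
    have := mul_le_mul_of_nonneg_left (hx (μ⁻¹ • h)) (norm_nonneg μ)
    rwa [e2, mul_inv_cancel_left₀ (norm_ne_zero_iff.2 hμ), ← srad_smul, ← e1] at this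
  have hnear : ∀ k : A, ‖k‖ ≤ 1 / 4 → srad ((1 + k) * x) = 0 := by
    intro k hk
    obtain ⟨v, hv⟩ := isUnit_one_add_of_srad_lt_one ((srad_le_norm k).trans_lt (by linarith))
    have hn := norm_one_sub_inv_le (by linarith) hv
    rw [← hv]
    refine srad_eq_zero_of_forall_isUnit fun μ => ?_
    have h1 : srad (((v⁻¹ : Aˣ) : A) - 1 + μ • x) < 1 :=
      ((hx' _ μ).trans (srad_le_norm _)).trans_lt (by rw [norm_sub_rev]; linarith)
    have h2 := v.isUnit.mul (isUnit_one_add_of_srad_lt_one h1)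
    rwa [← add_assoc, add_sub_cancel, mul_add, Units.mul_inv, mul_smul_comm] at h2
  refine mem_jacobson_bot_of_forall_isUnit fun y => isUnit_one_add_of_srad_lt_one ?_
  have hR : 0 < 4 * ‖y‖ + 1 := by positivity
  have := srad_le_of_forall_mem_frontier (U := Metric.ball (0 : ℂ) (4 * ‖y‖ + 1))
    Metric.isBounded_ball (f := fun s => s • x + y * x) (C := 0)
    (Differentiable.diffContOnCl (by fun_prop)) ?_ (z := 0) (subset_closure (by simpa using hR))
    le_rfl
  · rw [zero_smul, zero_add] at this
    linarith
  · intro s hs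
    have hs' := mem_sphere_zero_iff_norm.1 (Metric.frontier_ball_subset_sphere hs)
    have hs0 : s ≠ 0 := norm_pos_iff.1 (hs' ▸ hR)
    have e1 : s • x + y * x = s • ((1 + s⁻¹ • y) * x) := by
      rw [add_mul, one_mul, smul_add, smul_mul_assoc, smul_smul, mul_inv_cancel₀ hs0, one_smul]
    rw [e1, srad_smul, hnear, mul_zero]
    rw [norm_smul, norm_inv, hs', inv_mul_le_iff₀ hR]
    linarith

theorem srad_add_le_of_tendsto {x : A} {ξ : ℕ → A} (hξ : Tendsto ξ atTop (𝓝 x))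
    (hlim : ∀ (Y : A) (w : ℂ), w ≠ 0 → ∀ d > srad Y, ∀ᶠ n in atTop, srad (Y + w • ξ n) < d)
    (y : A) : srad (y + x) ≤ srad y := by
  refine le_of_forall_gt_imp_ge_of_dense fun c hc => ?_
  have hc0 : 0 < c := (srad_nonneg y).trans_lt hc
  have hnc : ‖(c : ℂ)⁻¹‖ = c⁻¹ := by rw [norm_inv, Complex.norm_real, Real.norm_of_nonneg hc0.le]
  obtain ⟨M, hM⟩ := hξ.norm.bddAbove_range
  have hM' : ∀ n, ‖ξ n‖ ≤ M := fun n => hM ⟨n, rfl⟩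
  have hcirc : ∀ θ : ℝ, ‖circleMap 0 1 θ‖ = 1 := fun θ => by simp
  have hc1 : c⁻¹ * srad y < 1 := by
    rw [inv_mul_lt_iff₀ hc0, mul_one]
    exact hc
  have hcont : Continuous fun p : ℝ × A => (c : ℂ)⁻¹ • (y + x + circleMap 0 1 p.1 • p.2) := by
    fun_prop
  have hev : ∀ᶠ p : ℝ × A in 𝓝 (Real.pi, x),
      srad ((c : ℂ)⁻¹ • (y + x + circleMap 0 1 p.1 • p.2)) < 1 := by
    refine hcont.continuousAt.eventually (eventually_srad_lt ?_)
    have : circleMap 0 1 Real.pi = -1 := by simp [circleMap]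
    simpa [this, srad_smul, abs_of_pos hc0] using hc1
  rw [nhds_prod_eq] at hev
  obtain ⟨P, hP, Q, hQ, hPQ⟩ := eventually_prod_iff.1 hev
  obtain ⟨κ, hκ, hκP⟩ := Metric.eventually_nhds_iff.1 hP
  have key := srad_le_one_of_asymptotic_bound
    (q := fun n w => (c : ℂ)⁻¹ • (y + x + w • ξ n)) (Y := (c : ℂ)⁻¹ • (y + x))
    (C := c⁻¹ * (‖y + x‖ + M)) (κ := min κ 1) (fun n => by fun_prop) (by simp) ?_ ?_
    (lt_min hκ one_pos) ((min_le_right _ _).trans_lt (by linarith [Real.pi_gt_three])) ?_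
  · rwa [srad_smul, hnc, inv_mul_le_iff₀ hc0, mul_one] at key
  · intro n θ
    rw [srad_smul, hnc]
    have : ‖y + x + circleMap 0 1 θ • ξ n‖ ≤ ‖y + x‖ + M :=
      (norm_add_le _ _).trans (by rw [norm_smul, hcirc, one_mul]; linarith [hM' n])
    have := (srad_le_norm _).trans this
    gcongr
  · intro θ d hd
    rw [srad_smul, hnc, gt_iff_lt, inv_mul_lt_iff₀ hc0] at hd
    filter_upwards [hlim (y + x) (circleMap 0 1 θ) (norm_pos_iff.1 (by rw [hcirc]; exact one_pos))
      _ hd] with n hn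
    rwa [srad_smul, hnc, inv_mul_lt_iff₀ hc0]
  · filter_upwards [hξ.eventually hQ] with n hn θ hθ
    exact (hPQ (hκP (hθ.trans_le (min_le_left _ _))) hn).le

/-- An additive bijection preserving spectral radii onto a Banach algebra with zero Jacobson
radical is bounded. -/
theorem exists_norm_map_le {B : Type*} [NormedRing B] [NormedAlgebra ℂ B] [CompleteSpace B]
    (hA : Ideal.jacobson (⊥ : Ideal A) = ⊥) (e : A ≃+ B) (he : ∀ x, srad (e x) = srad x) :
    ∃ M : ℝ, 0 ≤ M ∧ ∀ b : B, ‖e.symm b‖ ≤ M * ‖b‖ := by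
  let _ : NormedSpace ℚ A := NormedSpace.restrictScalars ℚ ℂ A
  let _ : NormedSpace ℚ B := NormedSpace.restrictScalars ℚ ℂ B
  set S : B →ₗ[ℚ] A := e.symm.toAddMonoidHom.toRatLinearMap
  have hcont : Continuous S := by
    refine S.continuous_of_seq_closed_graph fun β b x hβ hSβ => ?_
    have hξ : Tendsto (fun n => e.symm (β n - b)) atTop (𝓝 (x - e.symm b)) := by
      simp only [map_sub]
      exact Tendsto.sub_const hSβ _
    have hlim : ∀ (Y : A) (w : ℂ), w ≠ 0 → ∀ d > srad Y,
        ∀ᶠ n in atTop, srad (Y + w • e.symm (β n - b)) < d := by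
      intro Y w hw d hd
      have hw' : 0 < ‖w‖ := norm_pos_iff.2 hw
      have h1 : ∀ n, srad (Y + w • e.symm (β n - b)) = ‖w‖ * srad (e (w⁻¹ • Y) + (β n - b)) := by
        intro n
        have h2 : Y + w • e.symm (β n - b) = w • (w⁻¹ • Y + e.symm (β n - b)) := by
          rw [smul_add, smul_smul, mul_inv_cancel₀ hw, one_smul]
        rw [h2, srad_smul, ← he, map_add, e.apply_symm_apply]
      have h3 : Tendsto (fun n => e (w⁻¹ • Y) + (β n - b)) atTop (𝓝 (e (w⁻¹ • Y))) := by
        simpa using (hβ.sub_const b).const_add (e (w⁻¹ • Y))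
      have h4 : srad (e (w⁻¹ • Y)) < ‖w‖⁻¹ * d := by
        rw [he, srad_smul, norm_inv]
        gcongr
      filter_upwards [h3.eventually (eventually_srad_lt h4)] with n hn
      rw [h1, ← lt_inv_mul_iff₀ hw']
      exact hn
    have h := mem_jacobson_bot_of_srad_add_le (srad_add_le_of_tendsto hξ hlim)
    rw [hA, Ideal.mem_bot, sub_eq_zero] at h
    exact h
  exact ⟨‖(⟨S, hcont⟩ : B →L[ℚ] A)‖, norm_nonneg _,
    fun b => (⟨S, hcont⟩ : B →L[ℚ] A).le_opNorm b⟩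

end ClosedGraph

/-- A surjective additive spectrum preserving map from a semisimple complex unital
Banach algebra maps square-zero elements to square-zero elements. -/
theorem additive_spectrum_preserving_maps_square_zero
    {A B : Type*} [NormedRing A] [NormedAlgebra ℂ A] [CompleteSpace A]
    [NormedRing B] [NormedAlgebra ℂ B] [CompleteSpace B]
    (hA : Ideal.jacobson (⊥ : Ideal A) = ⊥)
    (T : A → B)
    (hsurj : Function.Surjective T)
    (hadd : ∀ x y : A, T (x + y) = T x + T y)
    (hspec : ∀ x : A, spectrum ℂ (T x) = spectrum ℂ x) :
    ∀ x : A, x * x = 0 → T x * T x = 0 := by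
  intro x hx
  have hunit : ∀ y, IsUnit (T y) ↔ IsUnit y := fun y => by
    rw [← spectrum.zero_notMem_iff ℂ, hspec, spectrum.zero_notMem_iff]
  have hrad : ∀ c : A, (∀ u : A, IsUnit u → IsUnit (u + c)) → c = 0 := fun c hc => by
    have := mem_jacobson_bot_of_forall_isUnit_add hc
    rwa [hA, Ideal.mem_bot] at this
  have hinj : Function.Injective (AddMonoidHom.mk' T hadd) := by
    refine (injective_iff_map_eq_zero _).2 fun c hc => hrad c fun u hu => ?_
    rw [AddMonoidHom.mk'_apply] at hc
    rwa [← hunit, hadd, hc, add_zero, hunit]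
  set e : A ≃+ B := AddEquiv.ofBijective (AddMonoidHom.mk' T hadd) ⟨hinj, hsurj⟩
  have heT : ∀ y, e y = T y := fun y => rfl
  have hsrad : ∀ y, srad (e y) = srad y := fun y => srad_congr_of_spectrum_eq (hspec y)
  obtain ⟨M, hM, hS⟩ := exists_norm_map_le hA e hsrad
  have hcontact : ∀ (h : B) (w : ℂ), ‖h‖ ≤ 1 → (2 * ‖x‖ * M + M ^ 2) * ‖h‖ < ‖w‖ ^ 2 →
      IsUnit (algebraMap ℂ B w - T x - h) := by
    intro h w hh hw
    have h1 : srad (T x + h) ^ 2 ≤ (2 * ‖x‖ * M + M ^ 2) * ‖h‖ := by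
      have h2 : e (x + e.symm h) = T x + h := by rw [map_add, e.apply_symm_apply, heT]
      have h3 : (x + e.symm h) ^ 2 = x * e.symm h + e.symm h * x + e.symm h * e.symm h := by
        rw [sq, add_mul, mul_add, mul_add, hx, zero_add, add_assoc]
      have h4 := hS h
      rw [← h2, hsrad]
      refine (srad_pow_le_norm_pow _ two_ne_zero).trans ?_
      rw [h3]
      calc ‖x * e.symm h + e.symm h * x + e.symm h * e.symm h‖
          ≤ ‖x‖ * ‖e.symm h‖ + ‖e.symm h‖ * ‖x‖ + ‖e.symm h‖ * ‖e.symm h‖ :=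
            norm_add₃_le.trans (by gcongr <;> exact norm_mul_le _ _)
        _ ≤ ‖x‖ * (M * ‖h‖) + M * ‖h‖ * ‖x‖ + M * ‖h‖ * (M * 1) := by
            gcongr
            exact h4.trans (by gcongr)
        _ = (2 * ‖x‖ * M + M ^ 2) * ‖h‖ := by ring
    have h5 : srad (T x + h) < ‖w‖ := lt_of_pow_lt_pow_left₀ 2 (norm_nonneg _) (h1.trans_lt hw)
    have h6 : w ∉ spectrum ℂ (T x + h) := fun hmem =>
      (norm_le_srad_of_mem_spectrum hmem).not_gt h5
    rwa [spectrum.notMem_iff, ← sub_sub] at h6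
  have hzero := srad_mul_mul_self_eq_zero (by positivity) hcontact
  have hc : e.symm (T x * T x) = 0 := by
    refine hrad _ fun y hy => ?_
    rw [← hunit, hadd, ← heT (e.symm _), e.apply_symm_apply]
    obtain ⟨v, hv⟩ := (hunit y).2 hy
    have h1 := v.isUnit.mul (isUnit_one_add_of_srad_lt_one
      (x := (v⁻¹ : Bˣ) * (T x * T x)) (by rw [hzero]; exact one_pos))
    rwa [mul_add, mul_one, Units.mul_inv_cancel_left, hv] at h1
  exact (map_eq_zero_iff _ e.symm.injective).1 hc
end

section
/- Let A be a unital C*-algebra of real rank zero, let B be a complex unital Banach algebra, and let T : A → B be a surjective additive map with σ(Tx) = σ(x) for all x ∈ A. Then T(a²) = (Ta)² for every self-adjoint element a ∈ A. -/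
open Filter Topology Metric

theorem le_of_forall_pow_le_mul_pow_s12 {t s K : ℝ} (hs : 0 ≤ s)
    (h : ∀ j : ℕ, t ^ j ≤ K * s ^ j) : t ≤ s := by
  by_contra! hst
  rcases hs.eq_or_lt with rfl | hs
  · have := h 1
    simp at this
    linarith
  · obtain ⟨j, hj⟩ := pow_unbounded_of_one_lt K ((one_lt_div hs).2 hst)
    rw [div_pow, lt_div_iff₀ (by positivity)] at hj
    exact absurd (h j) (not_le.2 hj)

section BanachAlgebra

variable {B : Type*} [NormedRing B] [NormedAlgebra ℂ B] [CompleteSpace B]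

theorem norm_le_of_mem_spectrum_of_norm_pow_le {x : B} {N : ℕ} (hN : N ≠ 0) {c : ℝ} (hc : 0 ≤ c)
    (h : ‖x ^ N‖ ≤ c ^ N) {μ : ℂ} (hμ : μ ∈ spectrum ℂ x) : ‖μ‖ ≤ c := by
  refine le_of_pow_le_pow_left₀ hN hc ?_
  refine le_of_forall_pow_le_mul_pow_s12 (K := ‖(1 : B)‖) (by positivity) fun j => ?_
  rcases Nat.eq_zero_or_pos j with rfl | hj
  · have : Nontrivial B := by
      by_contra hB
      rw [not_nontrivial_iff_subsingleton] at hB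
      simp [spectrum.of_subsingleton] at hμ
    simpa using one_le_norm_one B
  have h1 : μ ^ (N * j) ∈ spectrum ℂ (x ^ (N * j)) := spectrum.pow_mem_pow x _ hμ
  have h2 := spectrum.norm_le_norm_mul_of_mem h1
  rw [norm_pow, pow_mul, pow_mul] at h2
  calc _ ≤ _ := h2
    _ ≤ ‖x ^ N‖ ^ j * ‖(1 : B)‖ := by gcongr; exact norm_pow_le' _ hj
    _ ≤ (c ^ N) ^ j * ‖(1 : B)‖ := by gcongr
    _ = _ := mul_comm _ _

theorem exists_norm_pow_lt_of_spectrum_le {x : B} {M' M : ℝ} (hM' : 0 ≤ M') (hM : M' < M)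
    (h : ∀ μ ∈ spectrum ℂ x, ‖μ‖ ≤ M') : ∃ N : ℕ, N ≠ 0 ∧ ‖x ^ N‖ < M ^ N := by
  have hM0 : 0 < M := hM'.trans_lt hM
  have h1 : spectralRadius ℂ x < ENNReal.ofReal M := by
    refine lt_of_le_of_lt (b := ENNReal.ofReal M') ?_ ((ENNReal.ofReal_lt_ofReal_iff hM0).2 hM)
    refine iSup₂_le fun μ hμ => ?_
    rw [← enorm_eq_nnnorm, ← ofReal_norm]
    exact ENNReal.ofReal_le_ofReal (h μ hμ)
  have h2 := (spectrum.pow_norm_pow_one_div_tendsto_nhds_spectralRadius x).eventually_lt_const h1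
  obtain ⟨N, hN, hN1⟩ := (h2.and (eventually_ge_atTop 1)).exists
  refine ⟨N, by omega, ?_⟩
  rw [ENNReal.ofReal_lt_ofReal_iff hM0] at hN
  have h3 := pow_lt_pow_left₀ hN (by positivity) (by omega : N ≠ 0)
  rwa [← Real.rpow_natCast, ← Real.rpow_mul (norm_nonneg _), one_div,
    inv_mul_cancel₀ (by positivity), Real.rpow_one] at h3

omit [NormedAlgebra ℂ B] [CompleteSpace B] in
theorem IsCompact.exists_forall_norm_pow_le {K : Set ℂ} (hK : IsCompact K) {f : ℂ → B}
    (hf : ContinuousOn f K) {M : ℝ}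
    (h : ∀ z ∈ K, ∃ N : ℕ, N ≠ 0 ∧ ‖f z ^ N‖ < M ^ N) :
    ∃ N : ℕ, N ≠ 0 ∧ ∀ z ∈ K, ‖f z ^ N‖ ≤ M ^ N := by
  refine hK.induction_on (p := fun s => ∃ N : ℕ, N ≠ 0 ∧ ∀ z ∈ s, ‖f z ^ N‖ ≤ M ^ N)
    ⟨1, one_ne_zero, by simp⟩ ?_ ?_ ?_
  · rintro s t hst ⟨N, hN, h⟩
    exact ⟨N, hN, fun z hz => h z (hst hz)⟩
  · rintro s t ⟨N, hN, h⟩ ⟨N', hN', h'⟩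
    refine ⟨N * N', mul_ne_zero hN hN', ?_⟩
    rintro z (hz | hz)
    · rw [pow_mul, pow_mul]
      exact (norm_pow_le' _ (Nat.pos_of_ne_zero hN')).trans
        (pow_le_pow_left₀ (norm_nonneg _) (h z hz) _)
    · rw [mul_comm, pow_mul, pow_mul]
      exact (norm_pow_le' _ (Nat.pos_of_ne_zero hN)).trans
        (pow_le_pow_left₀ (norm_nonneg _) (h' z hz) _)
  · intro z hz
    obtain ⟨N, hN, h⟩ := h z hz
    have : ∀ᶠ w in 𝓝[K] z, ‖f w ^ N‖ < M ^ N :=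
      (((hf z hz).pow N).norm).eventually_lt_const h
    exact ⟨_, this, N, hN, fun w hw => le_of_lt hw⟩

/-- A Liouville theorem for the spectral radius of an analytic function with singularities at
`0` and `1`, near which the spectral radius stays bounded. -/
theorem spectrum_subset_zero_of_bounded {f : ℂ → B}
    (hf : ∀ z : ℂ, z * (z - 1) ≠ 0 → DifferentiableAt ℂ f z)
    {M : ℝ} (hM : 0 ≤ M)
    (hbdd : ∀ z : ℂ, z * (z - 1) ≠ 0 → ‖z * (z - 1)‖ ≤ 1 → ∀ μ ∈ spectrum ℂ (f z), ‖μ‖ ≤ M)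
    (hinf : ∀ η > 0, ∃ L₀ : ℝ, ∀ z : ℂ, L₀ ≤ ‖z * (z - 1)‖ → ‖f z‖ ≤ η)
    {z₀ : ℂ} (hz₀ : z₀ * (z₀ - 1) ≠ 0) : spectrum ℂ (f z₀) ⊆ {0} := by
  set g : ℂ → ℂ := fun z => z * (z - 1) with hg
  have hgc : Continuous g := by fun_prop
  have hg0 : 0 < ‖g z₀‖ := norm_pos_iff.2 hz₀
  have hcpt : ∀ L : ℝ, IsCompact {z : ℂ | ‖g z‖ ≤ L} := by
    intro L
    refine Metric.isCompact_of_isClosed_isBounded (isClosed_le hgc.norm continuous_const) ?_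
    refine (Metric.isBounded_closedBall (x := (0 : ℂ)) (r := |L| + 2)).subset fun z hz => ?_
    rw [mem_closedBall_zero_iff]
    by_contra! hlt
    have h1 : ‖z‖ - 1 ≤ ‖z - 1‖ := by simpa using norm_sub_norm_le z 1
    have h2 : ‖z‖ * ‖z - 1‖ ≤ L := by simpa [g] using hz
    nlinarith [le_abs_self L, abs_nonneg L]
  intro μ hμ
  suffices ∀ η > 0, ‖μ‖ ≤ η by
    simpa using le_of_forall_pos_le_add (a := ‖μ‖) (b := 0) (by simpa using this)
  intro η hη
  obtain ⟨L₀, hL₀⟩ := hinf η hη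
  set L := max (max L₀ 1) (‖g z₀‖ + 1) with hL
  have hLL₀ : L₀ ≤ L := (le_max_left _ _).trans (le_max_left _ _)
  have hL1 : 1 ≤ L := (le_max_right _ _).trans (le_max_left _ _)
  have hLz : ‖g z₀‖ < L := (lt_add_one _).trans_le (le_max_right _ _)
  refine le_of_forall_pow_le_mul_pow_s12 (K := L / ‖g z₀‖) hη.le fun n => ?_
  rw [div_mul_eq_mul_div, le_div_iff₀ hg0, mul_comm]
  rcases Nat.eq_zero_or_pos n with rfl | hn
  · simpa using hLz.le
  have key : ∀ ρ : ℝ, 0 < ρ → ρ ≤ 1 → ρ < ‖g z₀‖ →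
      ‖g z₀‖ * ‖μ‖ ^ n ≤ ρ * (M + 1) ^ n + L * η ^ n := by
    intro ρ hρ hρ1 hρz
    have hK : IsCompact {z : ℂ | ‖g z‖ = ρ} :=
      (hcpt ρ).of_isClosed_subset (isClosed_eq hgc.norm continuous_const) fun z hz => le_of_eq hz
    have hK0 : ∀ z, ‖g z‖ = ρ → g z ≠ 0 := fun z hz => norm_pos_iff.1 (hz ▸ hρ)
    obtain ⟨N, hN, hNb⟩ := hK.exists_forall_norm_pow_le (f := f) (M := M + 1)
      (fun z hz => (hf z (hK0 z hz)).continuousAt.continuousWithinAt)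
      fun z hz => exists_norm_pow_lt_of_spectrum_le hM (lt_add_one M)
        (hbdd z (hK0 z hz) (hz.trans_le hρ1))
    set c := ρ * (M + 1) ^ n + L * η ^ n with hc
    set F : ℂ → B := fun z => (g z • f z ^ n) ^ N with hF
    set U : Set ℂ := {z | ρ < ‖g z‖ ∧ ‖g z‖ < L} with hU
    have hclU : closure U ⊆ {z | ρ ≤ ‖g z‖ ∧ ‖g z‖ ≤ L} :=
      closure_minimal (fun z hz => ⟨hz.1.le, hz.2.le⟩)
        ((isClosed_le continuous_const hgc.norm).inter (isClosed_le hgc.norm continuous_const))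
    have hUo : IsOpen U :=
      (isOpen_lt continuous_const hgc.norm).inter (isOpen_lt hgc.norm continuous_const)
    have hFd : DiffContOnCl ℂ F U := by
      refine DifferentiableOn.diffContOnCl fun z hz => ?_
      have hz0 : g z ≠ 0 := norm_pos_iff.1 (hρ.trans_le (hclU hz).1)
      have h1 : DifferentiableAt ℂ g z := by fun_prop
      exact ((h1.smul ((hf z hz0).pow n)).pow N).differentiableWithinAt
    have hbound : ‖F z₀‖ ≤ c ^ N := by
      refine Complex.norm_le_of_forall_mem_frontier_norm_le
        ((hcpt L).isBounded.subset fun z hz => hz.2.le) hFd ?_ (subset_closure ⟨hρz, hLz⟩)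
      intro z hz
      have hz' := hclU hz.1
      have hzU : z ∉ U := by rw [hUo.frontier_eq] at hz; exact hz.2
      have hF' : ‖F z‖ = ‖g z‖ ^ N * ‖(f z ^ n) ^ N‖ := by
        rw [hF]; simp only [smul_pow, norm_smul, norm_pow]
      rw [hF']
      rcases hz'.1.eq_or_lt with h | h
      · calc ‖g z‖ ^ N * ‖(f z ^ n) ^ N‖ ≤ ρ ^ N * ((M + 1) ^ N) ^ n := by
              rw [← h, ← pow_mul, mul_comm n, pow_mul]
              gcongr
              exact (norm_pow_le' _ hn).trans
                (pow_le_pow_left₀ (norm_nonneg _) (hNb z h.symm) _)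
          _ = (ρ * (M + 1) ^ n) ^ N := by rw [mul_pow, ← pow_mul, ← pow_mul, mul_comm n]
          _ ≤ c ^ N := by
              apply pow_le_pow_left₀ (by positivity)
              rw [hc]; exact le_add_of_nonneg_right (by positivity)
      · have h' : ‖g z‖ = L := hz'.2.eq_of_not_lt fun h2 => hzU ⟨h, h2⟩
        calc ‖g z‖ ^ N * ‖(f z ^ n) ^ N‖ ≤ L ^ N * (η ^ n) ^ N := by
              rw [h']
              gcongr
              refine (norm_pow_le' _ (Nat.pos_of_ne_zero hN)).trans ?_
              gcongr
              refine (norm_pow_le' _ hn).trans ?_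
              gcongr
              exact hL₀ z (hLL₀.trans h'.ge)
          _ = (L * η ^ n) ^ N := by rw [mul_pow]
          _ ≤ c ^ N := by
              apply pow_le_pow_left₀ (by positivity)
              rw [hc]; exact le_add_of_nonneg_left (by positivity)
    have hmem : g z₀ * μ ^ n ∈ spectrum ℂ (g z₀ • f z₀ ^ n) := by
      have := spectrum.pow_mem_pow (f z₀) n hμ
      have h2 := (spectrum.smul_mem_smul_iff (r := Units.mk0 (g z₀) hz₀)).2 this
      simpa [Units.smul_def] using h2
    have := norm_le_of_mem_spectrum_of_norm_pow_le hN (by positivity) hbound hmem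
    simpa using this
  have hlim : Tendsto (fun ρ : ℝ => ρ * (M + 1) ^ n + L * η ^ n) (𝓝[>] 0) (𝓝 (L * η ^ n)) := by
    have : ContinuousAt (fun ρ : ℝ => ρ * (M + 1) ^ n + L * η ^ n) 0 := by fun_prop
    simpa using this.tendsto.mono_left nhdsWithin_le_nhds
  refine ge_of_tendsto hlim ?_
  filter_upwards [Ioc_mem_nhdsGT (zero_lt_one' ℝ), Ioo_mem_nhdsGT hg0] with ρ h1 h2
  exact key ρ h1.1 h1.2 h2.2

end BanachAlgebra

section Idempotent

variable {B : Type*} [NormedRing B] [NormedAlgebra ℂ B] [CompleteSpace B]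

omit [NormedAlgebra ℂ B] in
theorem exists_pos_forall_isUnit_one_sub :
    ∃ δ > 0, ∃ K > 0, ∀ u : B, ‖u‖ < δ → IsUnit (1 - u) ∧ ‖Ring.inverse (1 - u)‖ ≤ K := by
  have h1 : ∀ᶠ v : B in 𝓝 1, IsUnit v := Units.isOpen.mem_nhds isUnit_one
  have h2 : ∀ᶠ v : B in 𝓝 1, ‖Ring.inverse v‖ < ‖(1 : B)‖ + 1 := by
    have := (NormedRing.inverse_continuousAt (1 : Bˣ)).norm
    refine this.eventually_lt_const ?_
    simp
  obtain ⟨δ, hδ, h⟩ := Metric.eventually_nhds_iff.1 (h1.and h2)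
  refine ⟨δ, hδ, ‖(1 : B)‖ + 1, by positivity, fun u hu => ?_⟩
  have := h (y := 1 - u) (by simpa [dist_eq_norm] using hu)
  exact ⟨this.1, this.2.le⟩

/-- If small perturbations of `e` have their spectrum linearly close to `{0, 1}`, then
`(e - e²) B` consists of quasinilpotent elements. -/
theorem spectrum_sub_sq_mul_subset_zero {e : B} {C : ℝ} (hC : 0 < C)
    (H : ∀ (z : ℂ) (y : B), C * (C + ‖z‖) * ‖y‖ < ‖z * (z - 1)‖ →
      IsUnit (algebraMap ℂ B z - e - y)) (y : B) :
    spectrum ℂ ((e - e * e) * y) ⊆ {0} := by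
  set w := e - e * e with hw
  have hres : ∀ z : ℂ, z * (z - 1) ≠ 0 → IsUnit (algebraMap ℂ B z - e) := fun z hz => by
    simpa using H z 0 (by rw [norm_zero, mul_zero]; exact norm_pos_iff.2 hz)
  suffices ∀ y : B, ∀ z : ℂ, z * (z - 1) ≠ 0 → spectrum ℂ (w * resolvent e z * y) ⊆ {0} by
    have h2 := this ((algebraMap ℂ B 2 - e) * y) 2 (by norm_num)
    rwa [mul_assoc, ← mul_assoc (resolvent e 2), resolvent,
      Ring.inverse_mul_cancel _ (hres 2 (by norm_num)), one_mul] at h2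
  clear y
  intro y z hz
  obtain ⟨δ, hδ, K, hK, hinv⟩ := exists_pos_forall_isUnit_one_sub (B := B)
  set E := 3 * ‖(1 : B)‖ + ‖e‖ with hE
  refine spectrum_subset_zero_of_bounded (f := fun z => w * resolvent e z * y)
    (M := E * ‖y‖ / δ + C * (C + 2) * (‖y‖ * K)) (fun z hz => ?_) (by positivity)
    (fun z hz hz1 μ hμ => ?_) (fun η hη => ?_) hz
  · have := (spectrum.hasDerivAt_resolvent_const_left (hres z hz)).differentiableAt
    fun_prop
  · by_contra! hlt
    have hμ0 : 0 < ‖μ‖ := lt_of_le_of_lt (by positivity) hlt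
    have hμne : μ ≠ 0 := norm_pos_iff.1 hμ0
    have hz2 : ‖z‖ ≤ 2 := by
      by_contra! h2
      have h1 : ‖z‖ - 1 ≤ ‖z - 1‖ := by simpa using norm_sub_norm_le z 1
      rw [norm_mul] at hz1
      nlinarith
    refine hμ ?_
    set u := μ⁻¹ • ((algebraMap ℂ B (z - 1) + e) * y) with hu
    have hun : ‖u‖ < δ := by
      have h1 : ‖algebraMap ℂ B (z - 1) + e‖ ≤ E := by
        refine (norm_add_le _ _).trans ?_
        rw [norm_algebraMap, hE]
        have : ‖z - 1‖ ≤ 3 := (norm_sub_le _ _).trans (by simp; linarith)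
        gcongr
      have h2 : ‖u‖ ≤ ‖μ‖⁻¹ * (E * ‖y‖) := by
        rw [hu, norm_smul, norm_inv]
        gcongr
        exact (norm_mul_le _ _).trans (by gcongr)
      refine h2.trans_lt ?_
      have h3 : E * ‖y‖ / δ < ‖μ‖ := lt_of_le_of_lt (le_add_of_nonneg_right (by positivity)) hlt
      rw [div_lt_iff₀ hδ] at h3
      rwa [inv_mul_lt_iff₀ hμ0]
    obtain ⟨hvu, hvK⟩ := hinv u hun
    set v' := Ring.inverse (1 - u) with hv'
    have hHu := H z (-(μ⁻¹ • (z * (z - 1)) • (y * v'))) (by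
      rw [norm_neg, norm_smul, norm_smul, norm_inv]
      have h3 : C * (C + 2) * (‖y‖ * K) < ‖μ‖ :=
        lt_of_le_of_lt (le_add_of_nonneg_left (by positivity)) hlt
      have h4 : 0 < ‖z * (z - 1)‖ := norm_pos_iff.2 hz
      calc C * (C + ‖z‖) * (‖μ‖⁻¹ * (‖z * (z - 1)‖ * ‖y * v'‖))
          ≤ C * (C + 2) * (‖μ‖⁻¹ * (‖z * (z - 1)‖ * (‖y‖ * K))) := by
            gcongr
            exact (norm_mul_le _ _).trans (by gcongr)
        _ = ‖μ‖⁻¹ * (C * (C + 2) * (‖y‖ * K)) * ‖z * (z - 1)‖ := by ring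
        _ < 1 * ‖z * (z - 1)‖ := by
            gcongr
            rwa [inv_mul_lt_iff₀ hμ0, mul_one]
        _ = _ := one_mul _)
    have hd := hres z hz
    set d := algebraMap ℂ B z - e with hdd
    have hr : d * resolvent e z = 1 := Ring.mul_inverse_cancel _ hd
    have hdw : d * w = w * d := by
      rw [hdd, hw, Algebra.algebraMap_eq_smul_one]
      simp only [mul_sub, sub_mul, smul_mul_assoc, mul_smul_comm, one_mul, mul_one,
        mul_assoc, smul_sub]
      abel
    have hvv : v' * (1 - u) = 1 := Ring.inverse_mul_cancel _ hvu
    have hdz : d * (algebraMap ℂ B (z - 1) + e) = (z * (z - 1)) • 1 + w := by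
      rw [hdd, hw, Algebra.algebraMap_eq_smul_one, Algebra.algebraMap_eq_smul_one]
      simp only [mul_sub, sub_mul, smul_mul_assoc, mul_smul_comm, one_mul, mul_one, mul_add]
      module
    clear_value d
    have key : d * (algebraMap ℂ B μ - w * resolvent e z * y) =
        algebraMap ℂ B μ * ((d - -(μ⁻¹ • (z * (z - 1)) • (y * v'))) * (1 - u)) := by
      have h1 : d * (w * resolvent e z * y) = w * y := by
        rw [← mul_assoc, ← mul_assoc, hdw, mul_assoc w, hr, mul_one]
      have h2 : d * u = μ⁻¹ • ((z * (z - 1)) • y + w * y) := by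
        rw [hu, mul_smul_comm, ← mul_assoc, hdz, add_mul, smul_mul_assoc, one_mul]
      rw [mul_sub, h1, sub_neg_eq_add, add_mul, smul_mul_assoc, smul_mul_assoc, mul_assoc y, hvv,
        mul_one, mul_sub, h2, mul_one, Algebra.algebraMap_eq_smul_one, smul_mul_assoc, one_mul,
        mul_smul_comm, mul_one, smul_add, smul_sub, smul_inv_smul₀ hμne, smul_inv_smul₀ hμne]
      abel
    have hunit : IsUnit (d * (algebraMap ℂ B μ - w * resolvent e z * y)) := by
      rw [key]
      exact ((IsUnit.mk0 μ hμne).map (algebraMap ℂ B)).mul (hHu.mul hvu)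
    exact (IsUnit.mul_left_iff hd).1 hunit
  · have h1 : ∀ᶠ z in Bornology.cobounded ℂ, ‖w * resolvent e z * y‖ < η := by
      have := ((spectrum.resolvent_tendsto_cobounded (𝕜 := ℂ) e).const_mul w).mul_const y
      simp only [mul_zero, zero_mul] at this
      simpa using this.norm.eventually_lt_const (by simpa using hη)
    obtain ⟨R, -, hR⟩ := (hasBasis_cobounded_norm (E := ℂ)).eventually_iff.1 h1
    refine ⟨|R| * (|R| + 1), fun z hz => (hR ?_).le⟩
    by_contra hlt
    simp only [Set.mem_ofPred_eq, not_le] at hlt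
    have h2 : ‖z‖ < |R| := hlt.trans_le (le_abs_self R)
    have h3 : ‖z - 1‖ ≤ ‖z‖ + 1 := (norm_sub_le _ _).trans (by simp)
    rw [norm_mul] at hz
    nlinarith [norm_nonneg z, norm_nonneg (z - 1)]

omit [CompleteSpace B] in
theorem spectrum_add_subset_of_forall_mul {w : B} (h : ∀ y : B, spectrum ℂ (w * y) ⊆ {0}) (y : B) :
    spectrum ℂ (w + y) ⊆ spectrum ℂ y := by
  intro μ hμ hy
  refine hμ ?_
  change IsUnit _
  have hy : IsUnit (algebraMap ℂ B μ - y) := hy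
  have h1 : IsUnit (algebraMap ℂ B 1 - w * Ring.inverse (algebraMap ℂ B μ - y)) := by
    by_contra hn
    simpa using h _ (show (1 : ℂ) ∈ spectrum ℂ _ from hn)
  have h2 := h1.mul hy
  rw [sub_mul, mul_assoc, Ring.inverse_mul_cancel _ hy] at h2
  convert h2 using 1
  simp only [map_one, one_mul, mul_one]
  abel

end Idempotent

section CStarAlgebra

variable {A : Type*} [CStarAlgebra A]

theorem IsSelfAdjoint.norm_le_of_forall_mem_spectrum {a : A} (ha : IsSelfAdjoint a) {c : ℝ}
    (hc : 0 ≤ c) (h : ∀ μ ∈ spectrum ℂ a, ‖μ‖ ≤ c) : ‖a‖ ≤ c := by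
  have h1 : spectralRadius ℂ a ≤ ENNReal.ofReal c := by
    refine iSup₂_le fun μ hμ => ?_
    rw [← enorm_eq_nnnorm, ← ofReal_norm]
    exact ENNReal.ofReal_le_ofReal (h μ hμ)
  rw [ha.spectralRadius_eq_nnnorm, ← enorm_eq_nnnorm, ← ofReal_norm] at h1
  exact (ENNReal.ofReal_le_ofReal_iff hc).1 h1

theorem IsSelfAdjoint.eq_zero_of_spectrum_subset {a : A} (ha : IsSelfAdjoint a)
    (h : spectrum ℂ a ⊆ {0}) : a = 0 :=
  norm_le_zero_iff.1 <| ha.norm_le_of_forall_mem_spectrum le_rfl fun μ hμ => by simpa using h hμ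

theorem spectrum_zero_subset {B : Type*} [Ring B] [Algebra ℂ B] : spectrum ℂ (0 : B) ⊆ {0} := by
  rcases subsingleton_or_nontrivial B with hB | hB
  · simp [spectrum.of_subsingleton]
  · simp

theorem exists_eq_mul_of_mem_spectrum_smul {B : Type*} [Ring B] [Algebra ℂ B] {c : ℂ} (hc : c ≠ 0)
    {x : B} {μ : ℂ} (hμ : μ ∈ spectrum ℂ (c • x)) : ∃ ν ∈ spectrum ℂ x, μ = c * ν := by
  have h := spectrum.unit_smul_eq_smul x (Units.mk0 c hc)
  rw [Units.smul_mk0] at h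
  rw [h] at hμ
  obtain ⟨ν, hν, rfl⟩ := hμ
  exact ⟨ν, hν, rfl⟩

theorem eq_zero_of_spectrum_add_subset {a : A}
    (h : ∀ x : A, spectrum ℂ (a + x) ⊆ spectrum ℂ x) : a = 0 := by
  have h0 : spectrum ℂ a ⊆ {0} := by simpa using (h 0).trans spectrum_zero_subset
  have hstar : spectrum ℂ (star a) ⊆ {0} := by
    rw [spectrum.map_star]
    intro μ hμ
    simpa using h0 hμ
  have h1 : a + star a = 0 :=
    (IsSelfAdjoint.add_star_self a).eq_zero_of_spectrum_subset ((h _).trans hstar)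
  have h2 : a = star a := by
    refine sub_eq_zero.1 (sub_eq_add_neg a (star a) ▸ ?_)
    have hn : spectrum ℂ (a + -star a) ⊆ {0} := (h _).trans <| by
      rw [← spectrum.neg_eq]
      intro μ hμ
      simpa using hstar hμ
    have hI : IsSelfAdjoint (Complex.I • (a + -star a)) := by
      rw [isSelfAdjoint_iff]
      simp [smul_add]
      abel
    have h3 := hI.eq_zero_of_spectrum_subset fun μ hμ => by
      obtain ⟨ν, hν, rfl⟩ := exists_eq_mul_of_mem_spectrum_smul Complex.I_ne_zero hμ
      simpa using hn hν
    exact (smul_eq_zero.1 h3).resolve_left Complex.I_ne_zero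
  rw [← h2] at h1
  simpa using (two_smul ℂ a).trans h1

theorem exists_isSelfAdjoint_forall_isUnit_sub
    (hrr0 : ∀ a : A, IsSelfAdjoint a → a ∈ closure {x : A | IsSelfAdjoint x ∧ IsUnit x})
    (F : Finset ℝ) {h : A} (hh : IsSelfAdjoint h) {ε : ℝ} (hε : 0 < ε) :
    ∃ s : A, IsSelfAdjoint s ∧ ‖s - h‖ < ε ∧ ∀ t ∈ F, IsUnit (algebraMap ℂ A t - s) := by
  classical
  induction F using Finset.induction_on generalizing ε with
  | empty => exact ⟨h, hh, by simpa using hε, by simp⟩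
  | insert t F _ ih =>
    obtain ⟨s, hs, hsh, hsF⟩ := ih (half_pos hε)
    have hev : ∀ᶠ s' in 𝓝 s, ∀ t ∈ F, IsUnit (algebraMap ℂ A t - s') := by
      rw [Finset.eventually_all]
      intro t ht
      have : ContinuousAt (fun s' => algebraMap ℂ A t - s') s := by fun_prop
      exact this (Units.isOpen.mem_nhds (hsF t ht))
    obtain ⟨δ, hδ, hδF⟩ := Metric.eventually_nhds_iff.1 hev
    have ht : IsSelfAdjoint (algebraMap ℂ A t) :=
      IsSelfAdjoint.algebraMap A (by simp [isSelfAdjoint_iff])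
    obtain ⟨x, ⟨hx, hxu⟩, hxd⟩ := Metric.mem_closure_iff.1 (hrr0 _ (ht.sub hs)) (min δ (ε / 2))
      (lt_min hδ (half_pos hε))
    have hxs : ‖algebraMap ℂ A t - x - s‖ < min δ (ε / 2) := by
      rw [dist_eq_norm] at hxd
      rwa [sub_right_comm]
    refine ⟨algebraMap ℂ A t - x, ht.sub hx, ?_, ?_⟩
    · calc ‖algebraMap ℂ A t - x - h‖ ≤ ‖algebraMap ℂ A t - x - s‖ + ‖s - h‖ := by
            simpa using norm_add_le (algebraMap ℂ A t - x - s) (s - h)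
        _ < ε / 2 + ε / 2 := add_lt_add (hxs.trans_le (min_le_right _ _)) hsh
        _ = ε := add_halves ε
    · rintro r hr
      rcases Finset.mem_insert.1 hr with rfl | hr
      · simpa using hxu
      · exact hδF (by rw [dist_eq_norm]; exact hxs.trans_le (min_le_left _ _)) r hr

/-- Resolvent estimate: a self-adjoint element close to a non-invertible one has small
spectral values. -/
theorem IsSelfAdjoint.exists_mem_spectrum_of_norm_sub_lt {h s : A} (hs : IsSelfAdjoint s)
    {t r : ℝ} (hr : 0 < r) (ht : (t : ℂ) ∈ spectrum ℂ h) (hsh : ‖s - h‖ < r) :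
    ∃ z ∈ spectrum ℂ s, ‖z - t‖ ≤ r := by
  by_contra! hfar
  refine ht ?_
  change IsUnit _
  have hu : IsUnit (algebraMap ℂ A t - s) := by
    by_contra hn
    have := hfar t hn
    simp at this
    linarith
  set x := algebraMap ℂ A t - s with hx
  have hxsa : IsSelfAdjoint x :=
    (IsSelfAdjoint.algebraMap A (by simp [isSelfAdjoint_iff])).sub hs
  have hinv : ‖Ring.inverse x‖ ≤ r⁻¹ := by
    refine IsSelfAdjoint.norm_le_of_forall_mem_spectrum ?_ (by positivity) fun μ hμ => ?_
    · rw [isSelfAdjoint_iff, ← Ring.inverse_star, hxsa.star_eq]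
    · obtain ⟨u, hu'⟩ := hu
      rw [← hu', Ring.inverse_unit] at hμ
      have hμ0 : μ ≠ 0 := by
        rintro rfl
        exact spectrum.zero_notMem ℂ u⁻¹.isUnit hμ
      have h1 : (((Units.mk0 μ hμ0)⁻¹ : ℂˣ) : ℂ) ∈ spectrum ℂ (((u⁻¹)⁻¹ : Aˣ) : A) :=
        (spectrum.inv_mem_iff (r := Units.mk0 μ hμ0) (a := u⁻¹)).1 hμ
      rw [inv_inv, hu', hx, ← spectrum.singleton_sub_eq] at h1
      obtain ⟨_, rfl, z, hz, hzz⟩ := h1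
      have h2 := hfar z hz
      rw [← norm_neg, neg_sub] at h2
      change (t : ℂ) - z = _ at hzz
      rw [hzz] at h2
      simp at h2
      exact (le_inv_comm₀ hr (norm_pos_iff.2 hμ0)).1 h2.le
  have : algebraMap ℂ A t - h = (1 - (h - s) * Ring.inverse x) * x := by
    rw [sub_mul, mul_assoc, Ring.inverse_mul_cancel _ hu, hx]
    noncomm_ring
  rw [this]
  refine IsUnit.mul (isUnit_one_sub_of_norm_lt_one ?_) hu
  calc _ ≤ ‖h - s‖ * ‖Ring.inverse x‖ := norm_mul_le _ _
    _ ≤ ‖h - s‖ * r⁻¹ := by gcongr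
    _ < r * r⁻¹ := by rw [← norm_neg, neg_sub]; gcongr
    _ = 1 := mul_inv_cancel₀ hr.ne'

end CStarAlgebra

section Continuity

open scoped ComplexStarModule

theorem isUnit_sub_of_eventually_isUnit_sub_sub {A : Type*} [NormedRing A] [NormedAlgebra ℂ A]
    [CompleteSpace A] {s : A} {t : ℂ} {r : ℝ} (hr : 0 < r)
    (hs : ∀ l ∈ sphere t r, IsUnit (algebraMap ℂ A l - s)) {z : ℕ → A}
    (hz : Tendsto z atTop (𝓝 0))
    (hu : ∀ᶠ n in atTop, ∀ l ∈ closedBall t r, IsUnit (algebraMap ℂ A l - s - z n)) :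
    ∀ l ∈ closedBall t r, IsUnit (algebraMap ℂ A l - s) := by
  have halg : Continuous (algebraMap ℂ A) := continuous_algebraMap ℂ A
  have hcont : ∀ p : A × ℂ, IsUnit (algebraMap ℂ A p.2 - s - p.1) →
      ContinuousAt (fun p : A × ℂ => ‖Ring.inverse (algebraMap ℂ A p.2 - s - p.1)‖) p := by
    intro p hp
    have h1 : ContinuousAt (fun p : A × ℂ => algebraMap ℂ A p.2 - s - p.1) p := by fun_prop
    have h2 : ContinuousAt Ring.inverse (algebraMap ℂ A p.2 - s - p.1) := by
      simpa using NormedRing.inverse_continuousAt hp.unit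
    exact (ContinuousAt.comp (f := fun p : A × ℂ => algebraMap ℂ A p.2 - s - p.1) h2 h1).norm
  have hK : IsCompact (sphere t r) := isCompact_sphere t r
  obtain ⟨M, hM⟩ := hK.exists_bound_of_continuousOn
    (f := fun l => ‖Ring.inverse (algebraMap ℂ A l - s)‖) (fun l hl => by
      have := (hcont (0, l) (by simpa using hs l hl)).comp (f := fun l : ℂ => ((0 : A), l))
        (by fun_prop)
      simpa [Function.comp_def] using this.continuousWithinAt)
  have hev : ∀ᶠ x in 𝓝 (0 : A), ∀ l ∈ sphere t r,
      ‖Ring.inverse (algebraMap ℂ A l - s - x)‖ < M + 1 := by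
    refine hK.eventually_forall_of_forall_eventually fun l hl => ?_
    refine (hcont (0, l) (by simpa using hs l hl)).eventually_lt_const ?_
    have := hM l hl
    simp only [norm_norm] at this
    simp only [sub_zero]
    linarith
  intro l hl
  have hsmall : ∀ᶠ n in atTop, (M + 1) * ‖z n‖ < 1 := by
    have := hz.norm.const_mul (M + 1)
    rw [norm_zero, mul_zero] at this
    exact this.eventually_lt_const one_pos
  obtain ⟨n, hn1, hn2, hn3⟩ := (hu.and ((hz.eventually hev).and hsmall)).exists
  have hbound : ‖Ring.inverse (algebraMap ℂ A l - s - z n)‖ ≤ M + 1 := by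
    refine Complex.norm_le_of_forall_mem_frontier_norm_le (U := ball t r)
      (f := fun l => Ring.inverse (algebraMap ℂ A l - s - z n)) isBounded_ball ?_ ?_
      (by rwa [closure_ball t hr.ne'])
    · refine DifferentiableOn.diffContOnCl fun x hx => ?_
      rw [closure_ball t hr.ne'] at hx
      have h1 : DifferentiableAt ℂ (fun l : ℂ => algebraMap ℂ A l - s - z n) x := by
        have : DifferentiableAt ℂ (algebraMap ℂ A) x :=
          (Algebra.linearMap ℂ A).toContinuousLinearMap.differentiableAt
        fun_prop
      exact ((differentiableAt_inverse (hn1 x hx)).comp x h1).differentiableWithinAt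
    · intro x hx
      rw [frontier_ball t hr.ne'] at hx
      exact (hn2 x hx).le
  have hx := hn1 l hl
  set x := algebraMap ℂ A l - s - z n with hxd
  have : algebraMap ℂ A l - s = x * (1 - -(Ring.inverse x * z n)) := by
    rw [sub_neg_eq_add, mul_add, ← mul_assoc, Ring.mul_inverse_cancel _ hx, hxd]
    simp
  rw [this]
  refine hx.mul (isUnit_one_sub_of_norm_lt_one ?_)
  rw [norm_neg]
  calc _ ≤ _ := norm_mul_le _ _
    _ ≤ (M + 1) * ‖z n‖ := by gcongr
    _ < 1 := hn3

variable {A : Type*} [CStarAlgebra A] {B : Type*} [NormedRing B] [NormedAlgebra ℂ B]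
  [CompleteSpace B]

theorem spectrum_subset_spectrum_add_of_tendsto
    (hrr0 : ∀ a : A, IsSelfAdjoint a → a ∈ closure {x : A | IsSelfAdjoint x ∧ IsUnit x})
    {T : A →+ B} (hspec : ∀ x : A, spectrum ℂ (T x) = spectrum ℂ x)
    {z : ℕ → A} (hz : Tendsto z atTop (𝓝 0)) {a : A}
    (hTz : Tendsto (fun n => T (z n)) atTop (𝓝 (T a))) {h : A} (hh : IsSelfAdjoint h) :
    spectrum ℂ h ⊆ spectrum ℂ (h + a) := by
  have hunit : ∀ (l : ℂ) (x : A),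
      IsUnit (algebraMap ℂ B l - T x) ↔ IsUnit (algebraMap ℂ A l - x) := fun l x => by
    have := congrArg (l ∈ ·) (hspec x)
    simpa [spectrum.mem_iff, not_iff_not] using this
  have halgA : Continuous (algebraMap ℂ A) := continuous_algebraMap ℂ A
  have halgB : Continuous (algebraMap ℂ B) := continuous_algebraMap ℂ B
  intro τ hτ
  obtain ⟨t, rfl⟩ : ∃ t : ℝ, τ = t := ⟨τ.re, hh.mem_spectrum_eq_re hτ⟩
  by_contra hn
  have hn : IsUnit (algebraMap ℂ A t - (h + a)) := by simpa [spectrum.mem_iff] using hn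
  have hev : ∀ᶠ p : ℂ × A in 𝓝 ((t : ℂ), h), IsUnit (algebraMap ℂ A p.1 - (p.2 + a)) := by
    have : ContinuousAt (fun p : ℂ × A => algebraMap ℂ A p.1 - (p.2 + a)) ((t : ℂ), h) := by
      fun_prop
    exact this (Units.isOpen.mem_nhds hn)
  obtain ⟨δ, hδ, hball⟩ := Metric.eventually_nhds_iff.1 hev
  set r := δ / 2 with hr
  have hr0 : 0 < r := half_pos hδ
  have hrδ : r < δ := half_lt_self hδ
  obtain ⟨s, hs, hsh, hsF⟩ := exists_isSelfAdjoint_forall_isUnit_sub hrr0 {t - r, t + r} hh hr0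
  have hsa : ∀ l ∈ closedBall (t : ℂ) r, IsUnit (algebraMap ℂ A l - (s + a)) := fun l hl =>
    hball (y := (l, s)) <| by
      rw [Prod.dist_eq, max_lt_iff, dist_eq_norm s h]
      exact ⟨(mem_closedBall.1 hl).trans_lt hrδ, hsh.trans hrδ⟩
  have hsphere : ∀ l ∈ sphere (t : ℂ) r, IsUnit (algebraMap ℂ A l - s) := by
    intro l hl
    by_contra hl'
    obtain ⟨x, rfl⟩ : ∃ x : ℝ, l = x := ⟨l.re, hs.mem_spectrum_eq_re hl'⟩
    rw [mem_sphere, dist_eq_norm, ← Complex.ofReal_sub, Complex.norm_real, Real.norm_eq_abs] at hl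
    refine hl' (hsF x ?_)
    rw [Finset.mem_insert, Finset.mem_singleton]
    rcases abs_cases (x - t) with ⟨h1, -⟩ | ⟨h1, -⟩
    · right; linarith
    · left; linarith
  have hevB : ∀ᶠ b in 𝓝 (T a), ∀ l ∈ closedBall (t : ℂ) r,
      IsUnit (algebraMap ℂ B l - (T s + b)) := by
    refine (isCompact_closedBall (t : ℂ) r).eventually_forall_of_forall_eventually fun l hl => ?_
    have : ContinuousAt (fun p : B × ℂ => algebraMap ℂ B p.2 - (T s + p.1)) (T a, l) := by
      fun_prop
    refine this (Units.isOpen.mem_nhds ?_)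
    change IsUnit (algebraMap ℂ B l - (T s + T a))
    rw [← map_add, hunit]
    exact hsa l hl
  have hall := isUnit_sub_of_eventually_isUnit_sub_sub hr0 hsphere hz <| by
    filter_upwards [hTz.eventually hevB] with n hn l hl
    have := hn l hl
    rwa [← map_add, hunit, ← sub_sub] at this
  obtain ⟨ζ, hζ, hζt⟩ := hs.exists_mem_spectrum_of_norm_sub_lt hr0 hτ hsh
  exact hζ (hall ζ (by rwa [mem_closedBall, dist_eq_norm]))

theorem eq_zero_of_forall_isSelfAdjoint_spectrum_subset {a : A}
    (ha : ∀ h : A, IsSelfAdjoint h → spectrum ℂ h ⊆ spectrum ℂ (h + a)) : a = 0 := by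
  have hsum : a = (ℜ a : A) + Complex.I • (ℑ a : A) := (realPart_add_I_smul_imaginaryPart a).symm
  set u : A := (ℜ a : A) with hu
  set v : A := (ℑ a : A) with hv
  have husa : IsSelfAdjoint u := (ℜ a).2
  have hvsa : IsSelfAdjoint v := (ℑ a).2
  have hu0 : u = 0 := by
    refine neg_eq_zero.1 (husa.neg.eq_zero_of_spectrum_subset fun μ hμ => ?_)
    have h1 := ha _ husa.neg hμ
    rw [hsum, neg_add_cancel_left] at h1
    obtain ⟨ν, hν, rfl⟩ := exists_eq_mul_of_mem_spectrum_smul Complex.I_ne_zero h1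
    have h2 := husa.neg.im_eq_zero_of_mem_spectrum hμ
    have h3 := hvsa.im_eq_zero_of_mem_spectrum hν
    have : ν = 0 := Complex.ext (by simpa using h2) h3
    simp [this]
  have hv0 : v = 0 := by
    refine hvsa.eq_zero_of_spectrum_subset fun μ hμ => ?_
    have h1 := ha _ hvsa hμ
    have h4 : v + a = (1 + Complex.I) • v := by rw [hsum, hu0]; module
    have hI : (1 + Complex.I) ≠ 0 := fun h => by simpa using congrArg Complex.re h
    rw [h4] at h1
    obtain ⟨ν, hν, rfl⟩ := exists_eq_mul_of_mem_spectrum_smul hI h1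
    have h2 := hvsa.im_eq_zero_of_mem_spectrum hμ
    have h3 := hvsa.im_eq_zero_of_mem_spectrum hν
    have : ν = 0 := Complex.ext (by simpa [h3] using h2) h3
    simp [this]
  rw [hsum, hu0, hv0]
  simp

end Continuity

section SpectrumPreserving

variable {A : Type*} [CStarAlgebra A] {B : Type*} [NormedRing B] [NormedAlgebra ℂ B]

theorem injective_of_spectrum_eq {T : A →+ B}
    (hspec : ∀ x : A, spectrum ℂ (T x) = spectrum ℂ x) : Function.Injective T := by
  refine (injective_iff_map_eq_zero T).2 fun a ha => eq_zero_of_spectrum_add_subset fun x => ?_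
  rw [← hspec (a + x), map_add, ha, zero_add, hspec]

variable [CompleteSpace B]

theorem exists_continuousLinearEquiv_of_spectrum_eq
    (hrr0 : ∀ a : A, IsSelfAdjoint a → a ∈ closure {x : A | IsSelfAdjoint x ∧ IsUnit x})
    {T : A →+ B} (hsurj : Function.Surjective T)
    (hspec : ∀ x : A, spectrum ℂ (T x) = spectrum ℂ x) :
    ∃ S : A ≃L[ℝ] B, ∀ x, S x = T x := by
  have hclosed : ∀ (z : ℕ → A) (b : B), Tendsto z atTop (𝓝 0) →
      Tendsto (fun n => T (z n)) atTop (𝓝 b) → b = 0 := by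
    intro z b hz hb
    obtain ⟨a, rfl⟩ := hsurj b
    rw [eq_zero_of_forall_isSelfAdjoint_spectrum_subset fun h hh =>
      spectrum_subset_spectrum_add_of_tendsto hrr0 hspec hz hb hh, map_zero]
  have hsmul : ∀ (c : ℝ) (x : A), T (c • x) = c • T x := by
    intro c x
    obtain ⟨q, hq⟩ : ∃ q : ℕ → ℚ, Tendsto (fun n => (q n : ℝ)) atTop (𝓝 c) := by
      obtain ⟨u, -, -, hu⟩ := Real.exists_seq_rat_strictMono_tendsto c
      exact ⟨u, hu⟩
    have h1 : Tendsto (fun n => (q n : ℝ) • x - c • x) atTop (𝓝 0) := by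
      simpa using (hq.smul_const x).sub_const (c • x)
    have h2 : Tendsto (fun n => T ((q n : ℝ) • x - c • x)) atTop (𝓝 (c • T x - T (c • x))) := by
      simp only [map_sub, map_ratCast_smul T ℝ ℝ]
      exact (hq.smul_const (T x)).sub_const _
    exact (sub_eq_zero.1 (hclosed _ _ h1 h2)).symm
  let L : A →ₗ[ℝ] B := { T with map_smul' := hsmul }
  have hL : ∀ x, L x = T x := fun _ => rfl
  have hcont : Continuous L := L.continuous_of_seq_closed_graph fun u x y hu hTu => by
    refine sub_eq_zero.1 (hclosed (fun n => u n - x) (y - L x) (by simpa using hu.sub_const x) ?_)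
    simp only [map_sub, ← hL]
    exact hTu.sub_const _
  refine ⟨ContinuousLinearEquiv.ofBijective ⟨L, hcont⟩ ?_ ?_, fun x => rfl⟩
  · exact LinearMap.ker_eq_bot.2 (injective_of_spectrum_eq hspec)
  · exact LinearMap.range_eq_top.2 hsurj

theorem map_mul_self_of_isIdempotentElem {S : A ≃L[ℝ] B}
    (hspec : ∀ x : A, spectrum ℂ (S x) = spectrum ℂ x) {p : A} (hp : p * p = p) :
    S p * S p = S p := by
  obtain ⟨c, hc, hbound⟩ := (S.symm : B →L[ℝ] A).bound
  set C := c + ‖(1 : A)‖ + ‖p‖ + c * ‖(1 : A)‖ with hC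
  have hC0 : 0 < C := by positivity
  have H : ∀ (z : ℂ) (y : B), C * (C + ‖z‖) * ‖y‖ < ‖z * (z - 1)‖ →
      IsUnit (algebraMap ℂ B z - S p - y) := by
    intro z y hzy
    set x := S.symm y with hx
    have hxy : ‖x‖ ≤ c * ‖y‖ := hbound y
    have hg : z * (z - 1) ≠ 0 := norm_pos_iff.1 (lt_of_le_of_lt (by positivity) hzy)
    have hz : z ≠ 0 := left_ne_zero_of_mul hg
    suffices IsUnit (algebraMap ℂ A z - p - x) by
      have h1 : y = S x := (S.apply_symm_apply y).symm
      have h2 : z ∉ spectrum ℂ (p + x) := by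
        rwa [spectrum.mem_iff, not_not, ← sub_sub]
      rw [← hspec, spectrum.mem_iff, not_not, map_add, ← sub_sub, ← h1] at h2
      exact h2
    set q := (z * (z - 1))⁻¹ • (algebraMap ℂ A (z - 1) + p) with hq
    have e1 : (algebraMap ℂ A z - p) * (algebraMap ℂ A (z - 1) + p) = (z * (z - 1)) • 1 := by
      simp only [Algebra.algebraMap_eq_smul_one, sub_mul, mul_add, smul_mul_assoc,
        mul_smul_comm, one_mul, mul_one, hp]
      module
    have e2 : (algebraMap ℂ A (z - 1) + p) * (algebraMap ℂ A z - p) = (z * (z - 1)) • 1 := by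
      simp only [Algebra.algebraMap_eq_smul_one, add_mul, mul_sub, smul_mul_assoc,
        mul_smul_comm, one_mul, mul_one, hp]
      module
    have h1 : (algebraMap ℂ A z - p) * q = 1 := by
      rw [hq, mul_smul_comm, e1, inv_smul_smul₀ hg]
    have h2 : q * (algebraMap ℂ A z - p) = 1 := by
      rw [hq, smul_mul_assoc, e2, inv_smul_smul₀ hg]
    have hzp : IsUnit (algebraMap ℂ A z - p) := ⟨⟨_, q, h1, h2⟩, rfl⟩
    have hfac : algebraMap ℂ A z - p - x = (algebraMap ℂ A z - p) * (1 - q * x) := by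
      rw [mul_sub, ← mul_assoc, h1, mul_one, one_mul]
    rw [hfac]
    refine hzp.mul (isUnit_one_sub_of_norm_lt_one ?_)
    have hn : ‖algebraMap ℂ A (z - 1) + p‖ ≤ (‖z‖ + 1) * ‖(1 : A)‖ + ‖p‖ := by
      refine (norm_add_le _ _).trans ?_
      rw [norm_algebraMap]
      gcongr
      exact (norm_sub_le _ _).trans (by simp)
    have hCb : ((‖z‖ + 1) * ‖(1 : A)‖ + ‖p‖) * c ≤ C * (C + ‖z‖) := by
      have a1 : c ≤ C := by
        rw [hC]
        linarith [norm_nonneg p, norm_nonneg (1 : A), mul_nonneg hc.le (norm_nonneg (1 : A))]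
      have a2 : ‖(1 : A)‖ + ‖p‖ ≤ C := by
        rw [hC]; linarith [mul_nonneg hc.le (norm_nonneg (1 : A))]
      have a3 : c * ‖(1 : A)‖ ≤ C := by
        rw [hC]; linarith [norm_nonneg p, norm_nonneg (1 : A)]
      calc _ = c * (‖(1 : A)‖ + ‖p‖) + c * ‖(1 : A)‖ * ‖z‖ := by ring
        _ ≤ C * C + C * ‖z‖ := by gcongr
        _ = _ := by ring
    have hg' : 0 < ‖z * (z - 1)‖ := norm_pos_iff.2 hg
    calc ‖q * x‖ ≤ ‖z * (z - 1)‖⁻¹ * ((‖z‖ + 1) * ‖(1 : A)‖ + ‖p‖) * (c * ‖y‖) := by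
          refine (norm_mul_le _ _).trans ?_
          rw [hq, norm_smul, norm_inv]
          gcongr
      _ = ‖z * (z - 1)‖⁻¹ * (((‖z‖ + 1) * ‖(1 : A)‖ + ‖p‖) * c * ‖y‖) := by ring
      _ ≤ ‖z * (z - 1)‖⁻¹ * (C * (C + ‖z‖) * ‖y‖) := by gcongr
      _ < 1 := by rwa [inv_mul_lt_iff₀ hg', mul_one]
  have hw := spectrum_add_subset_of_forall_mul (spectrum_sub_sq_mul_subset_zero hC0 H)
  obtain ⟨a, ha⟩ := S.surjective (S p - S p * S p)
  have ha0 : a = 0 := eq_zero_of_spectrum_add_subset fun x => by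
    rw [← hspec (a + x), ← hspec x, map_add, ha]
    exact hw _
  rw [ha0, map_zero] at ha
  exact (sub_eq_zero.1 ha.symm).symm

theorem map_mul_add_map_mul_of_orthogonal {S : A ≃L[ℝ] B}
    (hspec : ∀ x : A, spectrum ℂ (S x) = spectrum ℂ x) {p q : A} (hp : p * p = p) (hq : q * q = q)
    (hpq : p * q = 0) (hqp : q * p = 0) : S p * S q + S q * S p = 0 := by
  have h := map_mul_self_of_isIdempotentElem hspec (p := p + q) (by
    simp only [add_mul, mul_add, hp, hq, hpq, hqp, add_zero, zero_add])
  simp only [map_add, add_mul, mul_add, map_mul_self_of_isIdempotentElem hspec hp,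
    map_mul_self_of_isIdempotentElem hspec hq] at h
  have : S p + S q * S p + (S p * S q + S q) = (S p + S q) + (S p * S q + S q * S p) := by abel
  rw [this] at h
  simpa using h

theorem two_smul_sum_smul_mul_self {R ι : Type*} [Ring R] [Algebra ℝ R] (F : Finset ι) (c : ι → ℝ)
    (x : ι → R) : (2 : ℝ) • ((∑ i ∈ F, c i • x i) * ∑ i ∈ F, c i • x i) =
      ∑ i ∈ F, ∑ j ∈ F, (c i * c j) • (x i * x j + x j * x i) := by
  simp only [smul_add, Finset.sum_add_distrib]
  rw [Finset.sum_comm (f := fun i j => (c i * c j) • (x j * x i)), two_smul, Finset.sum_mul_sum]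
  congr 1
  · simp only [smul_mul_smul_comm]
  · refine Finset.sum_congr rfl fun i _ => Finset.sum_congr rfl fun j _ => ?_
    rw [smul_mul_smul_comm, mul_comm (c i)]

theorem map_mul_self_sum_smul {S : A ≃L[ℝ] B}
    (hspec : ∀ x : A, spectrum ℂ (S x) = spectrum ℂ x) {ι : Type*} (F : Finset ι) (c : ι → ℝ)
    {p : ι → A} (hp : ∀ i, p i * p i = p i) (hpq : ∀ i j, i ≠ j → p i * p j = 0) :
    S ((∑ i ∈ F, c i • p i) * ∑ i ∈ F, c i • p i) =
      S (∑ i ∈ F, c i • p i) * S (∑ i ∈ F, c i • p i) := by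
  have hD : ∀ i j, S (p i * p j + p j * p i) = S (p i) * S (p j) + S (p j) * S (p i) := by
    intro i j
    by_cases hij : i = j
    · subst hij
      simp only [hp, map_add, map_mul_self_of_isIdempotentElem hspec (hp i)]
    · rw [map_mul_add_map_mul_of_orthogonal hspec (hp i) (hp j) (hpq i j hij)
        (hpq j i (Ne.symm hij)), hpq i j hij, hpq j i (Ne.symm hij), add_zero, map_zero]
  have h2 : (2 : ℝ) • S ((∑ i ∈ F, c i • p i) * ∑ i ∈ F, c i • p i) =
      (2 : ℝ) • (S (∑ i ∈ F, c i • p i) * S (∑ i ∈ F, c i • p i)) := by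
    rw [← map_smul, two_smul_sum_smul_mul_self]
    simp only [map_sum, map_smul, hD]
    rw [two_smul_sum_smul_mul_self]
  exact smul_right_injective B (two_ne_zero' ℝ) h2

end SpectrumPreserving

section FiniteSpectrum

variable {A : Type*} [CStarAlgebra A]

theorem IsSelfAdjoint.exists_norm_sum_smul_sub_le {s : A} (hs : IsSelfAdjoint s) {ε : ℝ}
    (hε : 0 < ε) {N : ℕ} (hN : ∀ x ∈ spectrum ℝ s, |x| ≤ N * ε)
    (hgap : ∀ k ∈ Finset.Icc (-N : ℤ) N, k * ε ∉ spectrum ℝ s) :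
    ∃ p : ℤ → A, (∀ i, p i * p i = p i) ∧ (∀ i j, i ≠ j → p i * p j = 0) ∧
      ‖∑ k ∈ Finset.Icc (-N : ℤ) N, (k * ε) • p k - s‖ ≤ ε := by
  set χ : ℤ → ℝ → ℝ := fun k x => if ⌊x / ε⌋ = k then 1 else 0 with hχ
  have hle : ∀ x ∈ spectrum ℝ s, -(N : ℝ) ≤ x / ε ∧ x / ε ≤ N := fun x hx => by
    have := abs_le.1 (hN x hx)
    exact ⟨by rw [le_div_iff₀ hε]; linarith, by rw [div_le_iff₀ hε]; linarith⟩
  have hfloor : ∀ x ∈ spectrum ℝ s, ⌊x / ε⌋ ∈ Finset.Icc (-N : ℤ) N := fun x hx => by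
    obtain ⟨h1, h2⟩ := hle x hx
    rw [Finset.mem_Icc]
    exact ⟨Int.le_floor.2 (by push_cast; exact h1),
      Int.cast_le (R := ℝ).1 ((Int.floor_le _).trans (by exact_mod_cast h2))⟩
  have hcont : ∀ k, ContinuousOn (χ k) (spectrum ℝ s) := by
    intro k x hx
    refine ContinuousAt.continuousWithinAt ?_
    have hlt : (⌊x / ε⌋ : ℝ) < x / ε := by
      refine (Int.floor_le _).lt_of_ne fun h => hgap _ (hfloor x hx) ?_
      rwa [h, div_mul_cancel₀ _ hε.ne']
    have hev : ∀ᶠ y in 𝓝 x, χ k y = χ k x := by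
      have h1 : ContinuousAt (fun y : ℝ => y / ε) x := by fun_prop
      filter_upwards [h1.eventually (Ioo_mem_nhds hlt (Int.lt_floor_add_one _))] with y hy
      have : ⌊y / ε⌋ = ⌊x / ε⌋ := Int.floor_eq_on_Ico _ _ ⟨hy.1.le, hy.2⟩
      simp only [hχ, this]
    exact continuousAt_const.congr (hev.mono fun y hy => hy.symm)
  refine ⟨fun k => cfc (χ k) s, fun i => ?_, fun i j hij => ?_, ?_⟩
  · rw [← cfc_mul (χ i) (χ i) s (hcont i) (hcont i)]
    congr 1
    ext x
    simp [hχ]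
  · rw [← cfc_mul (χ i) (χ j) s (hcont i) (hcont j)]
    have : (fun x => χ i x * χ j x) = fun _ => 0 := by
      ext x
      simp only [hχ]
      split_ifs with h1 h2
      · exact absurd (h1.symm.trans h2) hij
      all_goals simp
    rw [this, cfc_const_zero]
  · have hsum : ∑ k ∈ Finset.Icc (-N : ℤ) N, (k * ε) • cfc (χ k) s =
        cfc (fun x => ∑ k ∈ Finset.Icc (-N : ℤ) N, (k * ε) * χ k x) s := by
      rw [← Finset.sum_fn, cfc_sum (fun (k : ℤ) x => (k * ε) * χ k x) s _
        fun k _ => continuousOn_const.mul (hcont k)]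
      exact Finset.sum_congr rfl fun k _ => (cfc_const_mul _ (χ k) s (hcont k)).symm
    have hcs : ContinuousOn (fun x => ∑ k ∈ Finset.Icc (-N : ℤ) N, (k * ε) * χ k x)
        (spectrum ℝ s) :=
      continuousOn_finsetSum _ fun k _ => continuousOn_const.mul (hcont k)
    rw [hsum]
    nth_rw 2 [← cfc_id' ℝ s]
    rw [← cfc_sub _ (fun x => x) s hcs (continuousOn_id' _)]
    refine norm_cfc_le hε.le fun x hx => ?_
    have : ∑ k ∈ Finset.Icc (-N : ℤ) N, (k * ε) * χ k x = ⌊x / ε⌋ * ε := by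
      rw [Finset.sum_eq_single_of_mem _ (hfloor x hx) fun k _ hk => by simp [hχ, hk.symm]]
      simp [hχ]
    rw [this, Real.norm_eq_abs, abs_le]
    have h1 := Int.floor_le (x / ε)
    have h2 := Int.lt_floor_add_one (x / ε)
    rw [le_div_iff₀ hε] at h1
    rw [div_lt_iff₀ hε] at h2
    constructor <;> linarith

theorem exists_norm_sum_smul_idempotents_sub_lt
    (hrr0 : ∀ a : A, IsSelfAdjoint a → a ∈ closure {x : A | IsSelfAdjoint x ∧ IsUnit x})
    {h : A} (hh : IsSelfAdjoint h) {ε : ℝ} (hε : 0 < ε) :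
    ∃ (F : Finset ℤ) (c : ℤ → ℝ) (p : ℤ → A), (∀ i, p i * p i = p i) ∧
      (∀ i j, i ≠ j → p i * p j = 0) ∧ ‖∑ k ∈ F, c k • p k - h‖ < ε := by
  set η := ε / 2 with hη
  have hη0 : 0 < η := half_pos hε
  obtain ⟨N, hN⟩ := exists_nat_ge ((‖h‖ + η) * ‖(1 : A)‖ / η)
  obtain ⟨s, hs, hsh, hsF⟩ := exists_isSelfAdjoint_forall_isUnit_sub hrr0
    ((Finset.Icc (-N : ℤ) N).image fun k : ℤ => (k : ℝ) * η) hh hη0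
  have hsn : ‖s‖ ≤ ‖h‖ + η := by
    have := norm_le_norm_add_norm_sub' s h
    linarith
  obtain ⟨p, hp, hpq, hps⟩ := hs.exists_norm_sum_smul_sub_le hη0 (N := N)
    (fun x hx => by
      rw [div_le_iff₀ hη0] at hN
      exact (spectrum.norm_le_norm_mul_of_mem hx).trans (le_trans (by gcongr) hN))
    (fun k hk hmem => by
      have h1 := hsF _ (Finset.mem_image_of_mem _ hk)
      refine hmem ?_
      change IsUnit _
      convert h1 using 2
      exact IsScalarTower.algebraMap_apply ℝ ℂ A _)
  refine ⟨Finset.Icc (-N : ℤ) N, fun k : ℤ => k * η, p, hp, hpq, ?_⟩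
  calc _ ≤ ‖∑ k ∈ Finset.Icc (-N : ℤ) N, (k * η) • p k - s‖ + ‖s - h‖ :=
        norm_sub_le_norm_sub_add_norm_sub _ _ _
    _ < η + η := add_lt_add_of_le_of_lt hps hsh
    _ = ε := add_halves ε

end FiniteSpectrum

/-- If `A` is a unital C*-algebra of real rank zero and `T : A → B` is a surjective
additive spectrum preserving map into a complex unital Banach algebra, then
`T(a²) = (Ta)²` for every self-adjoint `a ∈ A`. -/
theorem square_preserved_on_selfAdjoints
    {A : Type*} [NormedRing A] [StarRing A] [CStarRing A] [NormedAlgebra ℂ A]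
    [CompleteSpace A] [StarModule ℂ A]
    (hrr0 : ∀ a : A, IsSelfAdjoint a → a ∈ closure {x : A | IsSelfAdjoint x ∧ IsUnit x})
    {B : Type*} [NormedRing B] [NormedAlgebra ℂ B] [CompleteSpace B]
    (T : A → B)
    (hsurj : Function.Surjective T)
    (hadd : ∀ x y : A, T (x + y) = T x + T y)
    (hspec : ∀ x : A, spectrum ℂ (T x) = spectrum ℂ x) :
    ∀ a : A, IsSelfAdjoint a → T (a * a) = T a * T a := by
  let : CStarAlgebra A := {}
  intro a ha
  obtain ⟨S, hS⟩ := exists_continuousLinearEquiv_of_spectrum_eq hrr0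
    (T := AddMonoidHom.mk' T hadd) hsurj hspec
  have hS : ∀ x, S x = T x := hS
  have hclosed : IsClosed {x : A | S (x * x) = S x * S x} :=
    isClosed_eq (by fun_prop) (by fun_prop)
  suffices a ∈ closure {x : A | S (x * x) = S x * S x} by
    rw [hclosed.closure_eq] at this
    have h : S (a * a) = S a * S a := this
    simpa only [hS] using h
  refine Metric.mem_closure_iff.2 fun ε hε => ?_
  obtain ⟨F, c, p, hp, hpq, hpa⟩ := exists_norm_sum_smul_idempotents_sub_lt hrr0 ha hε
  exact ⟨_, map_mul_self_sum_smul (fun x => by rw [hS, hspec]) F c hp hpq,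
    by rwa [dist_comm, dist_eq_norm]⟩
end

section
/- Let A be a unital C*-algebra of real rank zero, let B be a complex unital Banach algebra, let T : A → B be a surjective additive map with σ(Tx) = σ(x) for all x ∈ A (so T is bijective), and let S : A → B be a unital Jordan homomorphism with Sa = Ta for every self-adjoint a ∈ A. Put R = T⁻¹ ∘ S : A → A. Then the map R̃ : A → A defined by R̃x = ½(Rx − i·R(ix)) is a unital Jordan homomorphism: R̃ is complex-linear, R̃(1) = 1, and R̃(x²) = (R̃x)² for all x ∈ A. -/
section Compression

variable {A : Type*} [NormedRing A] [NormedAlgebra ℝ A] [CompleteSpace A]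

/-- If the compression of `x` to the corner of an idempotent `q` is invertible in that corner,
then `x` becomes invertible after adding a large multiple of `1 - q`. -/
theorem exists_isUnit_add_smul_one_sub {x q : A} (hq : q * q = q)
    (hx : IsUnit (q * x * q + (1 - q))) : ∃ t : ℝ, IsUnit (x + t • (1 - q)) := by
  obtain ⟨p, hp⟩ : ∃ p, p = 1 - q := ⟨_, rfl⟩
  have hqp : q * p = 0 := by rw [hp, mul_sub, hq, mul_one, sub_self]
  have hpq : p * q = 0 := by rw [hp, sub_mul, hq, one_mul, sub_self]
  have hpp : p * p = p := by rw [hp, mul_sub, ← hp, hpq, mul_one, sub_zero]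
  have hqp1 : q + p = 1 := by rw [hp]; abel
  rw [← hp] at hx ⊢
  obtain ⟨y, hy⟩ := hx
  have hcomm : Commute (y : A) q := by
    rw [hy]
    simp only [Commute, SemiconjBy, mul_add, add_mul, hqp, hpq, mul_assoc, hq]
    simp only [← mul_assoc, hq]
  have hcomm' : q * (↑y⁻¹ : A) = ↑y⁻¹ * q := (hcomm.units_inv_left).symm.eq
  have hz : (p * x * q * ↑y⁻¹) * (p * x * q * ↑y⁻¹) = 0 := by
    calc (p * x * q * ↑y⁻¹) * (p * x * q * ↑y⁻¹)
        = p * x * (q * ↑y⁻¹) * (p * x * q * ↑y⁻¹) := by simp only [mul_assoc]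
      _ = p * x * ↑y⁻¹ * (q * p) * (x * q * ↑y⁻¹) := by rw [hcomm']; simp only [mul_assoc]
      _ = 0 := by rw [hqp]; simp
  have hu : IsUnit (q * x * q + p + p * x * q) := by
    have h1 : IsUnit (1 + p * x * q * ↑y⁻¹) :=
      ⟨⟨_, 1 - p * x * q * ↑y⁻¹, by rw [add_mul, mul_sub, mul_sub, hz]; simp,
        by rw [sub_mul, mul_add, mul_add, hz]; simp⟩, rfl⟩
    have h2 : q * x * q + p + p * x * q = (1 + p * x * q * ↑y⁻¹) * y := by
      rw [add_mul, one_mul, hy.symm, Units.inv_mul_cancel_right]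
    rw [h2]
    exact h1.mul y.isUnit
  have hcont : Filter.Tendsto (fun s : ℝ => (q * x * q + p + p * x * q) + s • (x * p))
      (nhdsWithin 0 (Set.Ioi 0)) (nhds (q * x * q + p + p * x * q)) := by
    have : Continuous fun s : ℝ => (q * x * q + p + p * x * q) + s • (x * p) := by fun_prop
    simpa using (this.tendsto 0).mono_left nhdsWithin_le_nhds
  obtain ⟨s, hs, hs0⟩ :=
    ((hcont.eventually (Units.isOpen.mem_nhds hu)).and self_mem_nhdsWithin).exists
  have hs0' : s ≠ 0 := (ne_of_gt hs0)
  have hqs : (q + s • p) * (q + s⁻¹ • p) = 1 := by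
    simp [add_mul, mul_add, hq, hqp, hpq, hpp, smul_smul, hs0', hqp1]
  have hqs' : (q + s⁻¹ • p) * (q + s • p) = 1 := by
    simp [add_mul, mul_add, hq, hqp, hpq, hpp, smul_smul, hs0', hqp1]
  have hprod : (x + s⁻¹ • p) * (q + s • p) = (q * x * q + p + p * x * q) + s • (x * p) := by
    have : x * q = q * x * q + p * x * q := by
      rw [mul_assoc, mul_assoc, ← add_mul, hqp1, one_mul]
    rw [add_mul, mul_add, this]
    simp only [mul_add, smul_mul_assoc, mul_smul_comm, hpq, hpp, smul_smul,
      mul_inv_cancel₀ hs0', smul_zero, zero_add, one_smul]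
    abel
  refine ⟨s⁻¹, ?_⟩
  have h3 : x + s⁻¹ • p = ((q * x * q + p + p * x * q) + s • (x * p)) * (q + s⁻¹ • p) := by
    rw [← hprod, mul_assoc, hqs, mul_one]
  rw [h3]
  exact IsUnit.mul hs ⟨⟨_, _, hqs', hqs⟩, rfl⟩

end Compression

section Order

variable {A : Type*} [CStarAlgebra A] [PartialOrder A] [StarOrderedRing A]

/-- An element with strictly positive real part is invertible. -/
theorem isUnit_of_smul_one_le_add_star {y : A} {δ : ℝ} (hδ : 0 < δ)
    (h : δ • (1 : A) ≤ y + star y) : IsUnit y := by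
  obtain ⟨κ, hκ⟩ : ∃ κ, κ = δ / (‖y‖ ^ 2 + 1) := ⟨_, rfl⟩
  have hκ0 : 0 < κ := by rw [hκ]; positivity
  have hκ1 : κ * ‖y‖ ^ 2 < δ := by
    rw [hκ, div_mul_eq_mul_div, div_lt_iff₀ (by positivity)]
    nlinarith
  have hle : star (1 - κ • y) * (1 - κ • y) ≤
      algebraMap ℝ A (max (1 - κ * δ + κ ^ 2 * ‖y‖ ^ 2) 0) := by
    calc star (1 - κ • y) * (1 - κ • y)
        = 1 - κ • (y + star y) + κ ^ 2 • (star y * y) := by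
          simp only [star_sub, star_one, star_smul, star_trivial, sub_mul, mul_sub, one_mul,
            mul_one, smul_mul_assoc, mul_smul_comm, smul_smul, smul_add, smul_sub, pow_two]
          abel
      _ ≤ 1 - κ • (δ • (1 : A)) + κ ^ 2 • algebraMap ℝ A (‖y‖ ^ 2) := by
          gcongr
          exact CStarAlgebra.star_mul_le_algebraMap_norm_sq
      _ = algebraMap ℝ A (1 - κ * δ + κ ^ 2 * ‖y‖ ^ 2) := by
          simp only [Algebra.algebraMap_eq_smul_one, smul_smul, add_smul, sub_smul, one_smul]
      _ ≤ _ := algebraMap_mono A (le_max_left _ _)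
  have hnorm : ‖star (1 - κ • y) * (1 - κ • y)‖ < 1 :=
    ((CStarAlgebra.norm_le_iff_le_algebraMap _ (le_max_right _ _)
      (star_mul_self_nonneg _)).2 hle).trans_lt
      (max_lt (by nlinarith) one_pos)
  rw [CStarRing.norm_star_mul_self] at hnorm
  have h1 := isUnit_one_sub_of_norm_lt_one (x := 1 - κ • y) (by nlinarith [norm_nonneg (1 - κ • y)])
  rw [sub_sub_cancel] at h1
  have h2 : y = (κ⁻¹ • (1 : A)) * (κ • y) := by
    rw [smul_mul_assoc, one_mul, smul_smul, inv_mul_cancel₀ hκ0.ne', one_smul]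
  rw [h2]
  refine IsUnit.mul ?_ h1
  rw [← Algebra.algebraMap_eq_smul_one]
  exact (IsUnit.mk0 _ (inv_ne_zero hκ0.ne')).map (algebraMap ℝ A)

theorem IsStarProjection.compress_le_norm_smul {q h : A} (hq : IsStarProjection q)
    (hh : IsSelfAdjoint h) : q * h * q ≤ ‖h‖ • q := by
  have := hq.isSelfAdjoint.conjugate_le_conjugate (IsSelfAdjoint.le_algebraMap_norm_self hh)
  simpa [Algebra.algebraMap_eq_smul_one, hq.isIdempotentElem.eq] using this

/-- In real rank zero, a self-adjoint element that is not negative is bounded below on the corner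
of some nonzero projection. -/
theorem exists_isStarProjection_smul_le_compress
    (hrr0 : ∀ a : A, IsSelfAdjoint a → a ∈ closure {x : A | IsSelfAdjoint x ∧ IsUnit x})
    {c : A} (hc : IsSelfAdjoint c) (hc0 : ¬ c ≤ 0) :
    ∃ q : A, IsStarProjection q ∧ q ≠ 0 ∧ ∃ δ : ℝ, 0 < δ ∧ δ • q ≤ q * c * q := by
  obtain ⟨l, hl, hl0⟩ : ∃ l ∈ spectrum ℝ c, 0 < l := by
    by_contra! hcon
    exact hc0 (by simpa using le_algebraMap_of_spectrum_le (r := (0 : ℝ)) (a := c) hcon)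
  have hsub : IsSelfAdjoint (c - algebraMap ℝ A (l / 2)) :=
    hc.sub (IsSelfAdjoint.algebraMap A (IsSelfAdjoint.all _))
  obtain ⟨w, ⟨hw, hwu⟩, hdist⟩ := Metric.mem_closure_iff.1 (hrr0 _ hsub) (l / 4) (by positivity)
  rw [dist_eq_norm] at hdist
  obtain ⟨r, hr⟩ : ∃ r, r = c - algebraMap ℝ A (l / 2) - w := ⟨_, rfl⟩
  have hrsa : IsSelfAdjoint r := hr ▸ hsub.sub hw
  rw [← hr] at hdist
  have hcw : c = w + (l / 2) • (1 : A) + r := by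
    rw [hr, Algebra.algebraMap_eq_smul_one]; abel
  have h0 : (0 : ℝ) ∉ spectrum ℝ w := (spectrum.zero_notMem_iff ℝ).2 hwu
  have hcont : ContinuousOn (fun x : ℝ => if 0 < x then (1 : ℝ) else 0) (spectrum ℝ w) := by
    refine ContinuousOn.mono (s := {0}ᶜ) ?_ (fun x hx h => h0 (h ▸ hx))
    intro x hx
    refine ContinuousAt.continuousWithinAt ?_
    rcases lt_or_gt_of_ne (show x ≠ 0 from hx) with h | h
    · exact (continuousAt_const (y := (0 : ℝ))).congr <| by
        filter_upwards [Iio_mem_nhds h] with y hy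
        rw [if_neg (not_lt.2 (le_of_lt hy))]
    · exact (continuousAt_const (y := (1 : ℝ))).congr <| by
        filter_upwards [Ioi_mem_nhds h] with y hy
        rw [if_pos (Set.mem_Ioi.1 hy)]
  obtain ⟨q, hq⟩ : ∃ q, q = cfc (fun x : ℝ => if 0 < x then (1 : ℝ) else 0) w := ⟨_, rfl⟩
  have hqw : q * w = cfc (fun x : ℝ => (if 0 < x then (1 : ℝ) else 0) * x) w := by
    nth_rewrite 1 [← cfc_id ℝ w hw]
    rw [hq, ← cfc_mul _ _ w hcont]
    rfl
  have hqq : q * q = q := by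
    rw [hq, ← cfc_mul _ _ w hcont hcont]
    congr 1
    ext x
    split_ifs <;> simp
  have hqsa : IsSelfAdjoint q := hq ▸ cfc_predicate _ w
  have hproj : IsStarProjection q := ⟨hqq, hqsa⟩
  have hqwq : 0 ≤ q * w * q := by
    have : 0 ≤ q * w := by
      rw [hqw]
      refine cfc_nonneg fun x _ => ?_
      split_ifs with hx
      · simpa using hx.le
      · simp
    have h2 := hqsa.conjugate_nonneg this
    rwa [← mul_assoc, hqq] at h2
  refine ⟨q, hproj, ?_, l / 4, by positivity, ?_⟩
  · intro hq0
    have hw0 : w ≤ 0 := by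
      have : w = cfc (fun x : ℝ => x - (if 0 < x then (1 : ℝ) else 0) * x) w := by
        rw [cfc_sub (fun x : ℝ => x) (fun x => (if 0 < x then (1 : ℝ) else 0) * x) w
          continuousOn_id (hcont.mul continuousOn_id), ← hqw, hq0, zero_mul, sub_zero]
        exact (cfc_id ℝ w hw).symm
      rw [this]
      refine cfc_nonpos _ _ fun x _ => ?_
      split_ifs with hx
      · simp
      · simpa using hx
    have hcle : c ≤ algebraMap ℝ A (l / 2 + ‖r‖) := by
      calc c = w + (l / 2) • (1 : A) + r := hcw
        _ ≤ 0 + (l / 2) • (1 : A) + algebraMap ℝ A ‖r‖ := by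
          gcongr
          exact IsSelfAdjoint.le_algebraMap_norm_self hrsa
        _ = _ := by rw [zero_add, map_add, ← Algebra.algebraMap_eq_smul_one]
    have := (le_algebraMap_iff_spectrum_le hc).1 hcle l hl
    linarith
  · have hrle : -(q * r * q) ≤ ‖r‖ • q := by
      simpa using hproj.compress_le_norm_smul hrsa.neg
    have hq0 : 0 ≤ q := hproj.nonneg
    have hrle' : -(q * r * q) ≤ (l / 4) • q :=
      hrle.trans (smul_le_smul_of_nonneg_right hdist.le hq0)
    have hexp : q * c * q = q * w * q + (l / 2) • q + q * r * q := by
      rw [hcw]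
      simp [mul_add, add_mul, hqq]
    have hsum := add_le_add hqwq (neg_le.1 hrle')
    have : (l / 4) • q = 0 + -((l / 4) • q) + (l / 2) • q := by module
    rw [hexp, this]
    calc _ ≤ q * w * q + q * r * q + (l / 2) • q := by gcongr
      _ = _ := by abel

/-- The bottom `η` of the spectrum of the compression of a self-adjoint `h` to the corner of a
nonzero projection `q`, obtained from a noninvertible extension `n` of `q * h * q - η • q`. -/
theorem IsStarProjection.exists_bottom {q h : A} (hq : IsStarProjection q) (hq0 : q ≠ 0)
    (hh : IsSelfAdjoint h) :
    ∃ (η M : ℝ) (n : A), 0 < M ∧ 0 ≤ n ∧ ¬ IsUnit n ∧ n * q = q * h * q - η • q ∧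
      q * n = q * h * q - η • q ∧ (1 - q) * n = M • (1 - q) := by
  have : Nontrivial A := ⟨⟨q, 0, hq0⟩⟩
  have hqq : q * q = q := hq.isIdempotentElem.eq
  obtain ⟨K, hK⟩ : ∃ K, K = ‖h‖ + 1 := ⟨_, rfl⟩
  obtain ⟨m, hm⟩ : ∃ m, m = q * h * q + K • (1 - q) := ⟨_, rfl⟩
  have hmsa : IsSelfAdjoint m := by
    rw [hm]
    exact (hh.conjugate_self hq.isSelfAdjoint).add
      (IsSelfAdjoint.smul (IsSelfAdjoint.all K) ((IsSelfAdjoint.one A).sub hq.isSelfAdjoint))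
  obtain ⟨η, hη, hmin⟩ := (spectrum.isCompact (𝕜 := ℝ) m).exists_isLeast
    (ContinuousFunctionalCalculus.spectrum_nonempty m hmsa)
  have hle : algebraMap ℝ A η ≤ m := algebraMap_le_of_le_spectrum fun x hx => hmin hx
  have hqmq : q * m * q = q * h * q := by
    simp only [hm, mul_add, mul_smul_comm, mul_sub, mul_one, hqq, sub_self, smul_zero, add_zero,
      mul_assoc]
    simp only [← mul_assoc, hqq]
  have hηK : η < K := by
    by_contra! hcon
    have h1 : η • q ≤ q * m * q := by
      simpa [Algebra.algebraMap_eq_smul_one, hqq] using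
        hq.isSelfAdjoint.conjugate_le_conjugate hle
    rw [hqmq] at h1
    have h2 : η • q ≤ ‖h‖ • q := h1.trans (hq.compress_le_norm_smul hh)
    have h3 : (1 : ℝ) • q ≤ (η - ‖h‖) • q :=
      smul_le_smul_of_nonneg_right (by linarith) hq.nonneg
    rw [one_smul, sub_smul] at h3
    exact hq0 (le_antisymm (h3.trans (sub_nonpos.2 h2)) hq.nonneg)
  refine ⟨η, K - η, m - algebraMap ℝ A η, sub_pos.2 hηK, sub_nonneg.2 hle, ?_, ?_, ?_, ?_⟩
  · intro hu
    exact (spectrum.mem_iff.1 hη) (by simpa using hu.neg)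
  · rw [Algebra.algebraMap_eq_smul_one, hm]
    simp only [add_mul, sub_mul, smul_mul_assoc, one_mul, mul_assoc, hqq, sub_self, smul_zero,
      add_zero]
  · rw [Algebra.algebraMap_eq_smul_one, hm]
    simp only [mul_add, mul_sub, mul_smul_comm, mul_one, ← mul_assoc, hqq, sub_self, smul_zero,
      add_zero]
  · rw [Algebra.algebraMap_eq_smul_one, hm]
    simp only [mul_add, mul_sub, sub_mul, mul_smul_comm, mul_one, one_mul, ← mul_assoc, hqq,
      sub_self, zero_mul, smul_zero, sub_zero, sub_smul, smul_sub]
    abel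

open ComplexStarModule in
/-- If some multiple of `v - u` has strictly positive real part on the corner of a projection, a
self-adjoint translate of `u` has a spectral value which is not one of that translate of `v`. -/
theorem not_forall_spectrum_subset_of_compress {u v q : A} (hq : IsStarProjection q)
    (hq0 : q ≠ 0) {d : ℂ} (hd0 : d ≠ 0) (hd : d.im ≤ 0) {δ : ℝ} (hδ : 0 < δ)
    (hcomp : δ • q ≤ q * (d • (v - u) + star (d • (v - u))) * q) :
    ¬ ∀ a : A, IsSelfAdjoint a → spectrum ℂ (a + u) ⊆ spectrum ℂ (a + v) := by
  intro H
  have hqq : q * q = q := hq.isIdempotentElem.eq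
  have hqs : star q = q := hq.isSelfAdjoint
  obtain ⟨f, hf, h, hh, rfl⟩ : ∃ f : A, IsSelfAdjoint f ∧ ∃ h : A, IsSelfAdjoint h ∧
      u = f + Complex.I • h :=
    ⟨ℜ u, (ℜ u).2, ℑ u, (ℑ u).2, (realPart_add_I_smul_imaginaryPart u).symm⟩
  obtain ⟨η, M, n, hM, hn, hnu, hnq, hqn, hpn⟩ := hq.exists_bottom hq0 hh
  obtain ⟨u, hu⟩ : ∃ u, u = f + Complex.I • h := ⟨_, rfl⟩
  rw [← hu] at H hcomp
  obtain ⟨p, hp⟩ : ∃ p, p = 1 - q := ⟨_, rfl⟩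
  have hps : star p = p := by rw [hp, star_sub, star_one, hqs]
  have hqp : q * p = 0 := by rw [hp, mul_sub, hqq, mul_one, sub_self]
  have hpq : p * q = 0 := by rw [hp, sub_mul, hqq, one_mul, sub_self]
  have hqp1 : q + p = 1 := by rw [hp]; abel
  obtain ⟨b, hb⟩ : ∃ b, b = -(q * f * q) - p * u * q - q * star u * p := ⟨_, rfl⟩
  have hbs : IsSelfAdjoint b := by
    simp only [hb, IsSelfAdjoint, star_sub, star_neg, star_mul, hqs, hps, hf.star_eq, star_star,
      mul_assoc]
    abel
  have hbq : (b + u) * q = Complex.I • (q * h * q) := by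
    have h1 : u * q = q * u * q + p * u * q := by
      rw [mul_assoc, mul_assoc, ← add_mul, hqp1, one_mul]
    have h2 : q * u * q = q * f * q + Complex.I • (q * h * q) := by
      rw [hu, mul_add, add_mul, mul_smul_comm, smul_mul_assoc]
    rw [add_mul, h1, h2, hb]
    simp only [sub_mul, neg_mul, mul_assoc, hqq, hpq, mul_zero]
    abel
  have hqbq : q * b * q = -(q * f * q) := by
    simp only [hb, mul_sub, sub_mul, mul_neg, neg_mul, mul_assoc, hqq, hpq, mul_zero, sub_zero]
    simp only [← mul_assoc, hqq, hqp, zero_mul, sub_zero]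
  obtain ⟨x, hx⟩ : ∃ x, x = b + v - algebraMap ℂ A (Complex.I * η) := ⟨_, rfl⟩
  have hqxq : q * x * q = q * (v - u) * q + Complex.I • (n * q) := by
    rw [hx, hnq, hu, Algebra.algebraMap_eq_smul_one]
    simp only [mul_add, add_mul, mul_sub, sub_mul, hqbq, mul_smul_comm, smul_mul_assoc, mul_one,
      hqq, smul_sub, mul_smul, Complex.coe_smul]
    abel
  have hxu : IsUnit (q * x * q + (1 - q)) := by
    have hqnq : n * q = q * n * q := by rw [hqn, ← hnq, mul_assoc, hqq]
    have hnq0 : 0 ≤ n * q := hqnq ▸ hq.isSelfAdjoint.conjugate_nonneg hn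
    have hnqs : star (n * q) = n * q := (IsSelfAdjoint.of_nonneg hnq0)
    obtain ⟨y, hy⟩ : ∃ y, y = d • (q * x * q) + p := ⟨_, rfl⟩
    have hyeq : y + star y =
        q * (d • (v - u) + star (d • (v - u))) * q + (-2 * d.im) • (n * q) + (2 : ℝ) • p := by
      have hI : (-2 * d.im) • (n * q) =
          (d * Complex.I) • (n * q) + (star Complex.I * star d) • (n * q) := by
        rw [← add_smul, ← Complex.coe_smul]
        congr 1
        apply Complex.ext <;> simp
        ring
      rw [hI, hy, hqxq]
      simp only [star_add, star_smul, hnqs, hps, smul_add, mul_smul, mul_add, add_mul, star_mul,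
        hqs, mul_smul_comm, smul_mul_assoc, two_smul, mul_assoc]
      rw [smul_comm (star d) (star Complex.I)]
      abel
    have hyu : IsUnit y := by
      refine isUnit_of_smul_one_le_add_star (δ := min δ 2) (by positivity) ?_
      have hp0 : 0 ≤ p := hp ▸ hq.one_sub.nonneg
      rw [hyeq, ← hqp1, smul_add]
      have h1 : min δ 2 • q ≤ δ • q := smul_le_smul_of_nonneg_right (min_le_left _ _) hq.nonneg
      have h2 : min δ 2 • p ≤ (2 : ℝ) • p := smul_le_smul_of_nonneg_right (min_le_right _ _) hp0
      have h3 : 0 ≤ (-2 * d.im) • (n * q) := smul_nonneg (by linarith) hnq0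
      exact add_le_add ((h1.trans hcomp).trans (le_add_of_nonneg_right h3)) h2
    have hpp : p * p = p := by
      nth_rewrite 1 [hp]
      rw [sub_mul, one_mul, hqp, sub_zero]
    have hfac : q * x * q + (1 - q) = (d⁻¹ • q + p) * y := by
      rw [hy, ← hp]
      simp only [add_mul, mul_add, smul_mul_assoc, mul_smul_comm, ← mul_assoc, hqq, hpq, hqp, hpp,
        smul_zero, add_zero, zero_add, smul_smul, mul_inv_cancel₀ hd0, one_smul]
    rw [hfac]
    refine IsUnit.mul ⟨⟨_, d • q + p, ?_, ?_⟩, rfl⟩ hyu <;>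
      simp [add_mul, mul_add, hqq, hpq, hqp, hpp, smul_smul, hd0, hqp1]
  obtain ⟨t, ht⟩ := exists_isUnit_add_smul_one_sub hqq hxu
  rw [← hp] at ht hpn
  have hasa : IsSelfAdjoint (b + t • p) :=
    hbs.add (IsSelfAdjoint.smul (IsSelfAdjoint.all t) hps)
  have hmem : Complex.I * η ∈ spectrum ℂ (b + t • p + u) := by
    rw [spectrum.mem_iff]
    intro hunit
    rw [← IsUnit.neg_iff, neg_sub] at hunit
    obtain ⟨z, hz⟩ := hunit
    have hzq : (z : A) * q = Complex.I • (n * q) := by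
      have h1 : (b + t • p + u - algebraMap ℂ A (Complex.I * η)) * q =
          (b + u) * q - (Complex.I * η) • q := by
        rw [Algebra.algebraMap_eq_smul_one]
        simp only [add_mul, sub_mul, smul_mul_assoc, one_mul, hpq, smul_zero, add_zero]
      rw [hz, h1, hbq, hnq, smul_sub, mul_smul, Complex.coe_smul]
    have hleft : (Complex.I • (↑z⁻¹ * q) + M⁻¹ • p) * n = 1 := by
      have h2 : (↑z⁻¹ : A) * (Complex.I • (n * q)) = q := by
        rw [← hzq, Units.inv_mul_cancel_left]
      rw [add_mul, smul_mul_assoc, smul_mul_assoc, hpn, smul_smul, inv_mul_cancel₀ hM.ne',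
        one_smul, mul_assoc, hqn, ← hnq, ← mul_smul_comm, h2, hqp1]
    have hright : n * star (Complex.I • (↑z⁻¹ * q) + M⁻¹ • p) = 1 := by
      have := congrArg star hleft
      rwa [star_mul, star_one, (IsSelfAdjoint.of_nonneg hn).star_eq] at this
    exact hnu (isUnit_iff_exists_and_exists.2 ⟨⟨_, hright⟩, ⟨_, hleft⟩⟩)
  refine (spectrum.mem_iff.1 (H _ hasa hmem)) ?_
  rw [← IsUnit.neg_iff, neg_sub]
  have : b + t • p + v - algebraMap ℂ A (Complex.I * η) = x + t • p := by rw [hx]; abel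
  rwa [this]

open ComplexStarModule in
/-- In a real rank zero C*-algebra, an element is determined by the spectra of its self-adjoint
translates. -/
theorem eq_of_forall_spectrum_add_subset
    (hrr0 : ∀ a : A, IsSelfAdjoint a → a ∈ closure {x : A | IsSelfAdjoint x ∧ IsUnit x})
    {u v : A} (H : ∀ a : A, IsSelfAdjoint a → spectrum ℂ (a + u) ⊆ spectrum ℂ (a + v)) :
    u = v := by
  have key : ∀ u v : A,
      (∀ a : A, IsSelfAdjoint a → spectrum ℂ (a + u) ⊆ spectrum ℂ (a + v)) →
      ∀ d : ℂ, d ≠ 0 → d.im ≤ 0 → d • (v - u) + star (d • (v - u)) ≤ 0 := by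
    intro u v H d hd0 hd
    by_contra hcon
    obtain ⟨q, hq, hq0, δ, hδ, hle⟩ :=
      exists_isStarProjection_smul_le_compress hrr0 (IsSelfAdjoint.add_star_self _) hcon
    exact not_forall_spectrum_subset_of_compress hq hq0 hd0 hd hδ hle H
  have Hneg : ∀ a : A, IsSelfAdjoint a → spectrum ℂ (a + -u) ⊆ spectrum ℂ (a + -v) := by
    intro a ha
    have := H (-a) ha.neg
    rw [← Set.neg_subset_neg, spectrum.neg_eq, spectrum.neg_eq] at this
    simpa [neg_add, add_comm] using this
  have hzero : ∀ d : ℂ, d ≠ 0 → d.im ≤ 0 → d • (v - u) + star (d • (v - u)) = 0 := by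
    intro d hd0 hd
    refine le_antisymm (key u v H d hd0 hd) ?_
    have h2 := key _ _ Hneg d hd0 hd
    rw [← neg_sub', smul_neg, star_neg, ← neg_add, neg_nonpos] at h2
    exact h2
  have h1 := hzero 1 one_ne_zero (by simp)
  have h2 := hzero (-Complex.I) (by simp) (by simp)
  rw [one_smul] at h1
  rw [star_smul, eq_neg_of_add_eq_zero_right h1] at h2
  have h3 : (-Complex.I) • (v - u) + star (-Complex.I) • -(v - u) =
      (-2 * Complex.I) • (v - u) := by
    rw [star_neg, Complex.star_def, Complex.conj_I]
    module
  rw [h3, smul_eq_zero, sub_eq_zero] at h2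
  exact (h2.resolve_left (by simp)).symm

end Order

section Jordan

variable {A B : Type*} [Ring A] [Algebra ℂ A] [Ring B] [Algebra ℂ B]

theorem jordanHom_map_mul_mul {S : A →ₗ[ℂ] B} (hS : ∀ x : A, S (x * x) = S x * S x) (x y : A) :
    S (x * y * x) = S x * S y * S x := by
  have hanti : ∀ x y : A, S (x * y + y * x) = S x * S y + S y * S x := by
    intro x y
    have h := hS (x + y)
    simp only [mul_add, add_mul, map_add, hS] at h
    rw [← sub_eq_zero] at h ⊢
    rw [map_add, ← h]
    abel
  have h1 : (2 : ℂ) • (x * y * x) =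
      (x * (x * y + y * x) + (x * y + y * x) * x) - (x * x * y + y * (x * x)) := by
    rw [two_smul]; noncomm_ring
  have h2 := congrArg S h1
  rw [map_smul, map_sub, hanti, hanti, hanti, hS] at h2
  have h3 : (2 : ℂ) • (S (x * y * x) - S x * S y * S x) = 0 := by
    rw [smul_sub, h2, two_smul]; noncomm_ring
  simpa [sub_eq_zero] using h3

theorem jordanHom_isUnit {S : A →ₗ[ℂ] B} (hS1 : S 1 = 1)
    (hS : ∀ x : A, S (x * x) = S x * S x) {x : A} (hx : IsUnit x) : IsUnit (S x) := by
  obtain ⟨x, rfl⟩ := hx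
  have h := jordanHom_map_mul_mul hS (x : A) (↑x⁻¹ * ↑x⁻¹)
  rw [Units.mul_inv_cancel_left, Units.inv_mul, hS1] at h
  exact isUnit_iff_exists_and_exists.2
    ⟨⟨_, (by rw [← mul_assoc]; exact h.symm)⟩, ⟨_, h.symm⟩⟩

theorem jordanHom_spectrum_subset {S : A →ₗ[ℂ] B} (hS1 : S 1 = 1)
    (hS : ∀ x : A, S (x * x) = S x * S x) (x : A) : spectrum ℂ (S x) ⊆ spectrum ℂ x := by
  intro l hl
  rw [spectrum.mem_iff] at hl ⊢
  refine fun hu => hl ?_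
  have := jordanHom_isUnit hS1 hS hu
  rwa [map_sub, Algebra.algebraMap_eq_smul_one, map_smul, hS1,
    ← Algebra.algebraMap_eq_smul_one] at this

end Jordan

/-- With `T` a surjective additive spectrum preserving map from a real rank zero unital
C*-algebra `A` onto a complex unital Banach algebra `B`, `S` a unital Jordan
homomorphism agreeing with `T` on self-adjoint elements, and `R = T⁻¹ ∘ S` (i.e.
`T (R x) = S x` for all `x`), the map `R̃ x = ½(Rx − i·R(ix))` is a unital Jordan
homomorphism on `A`. -/
theorem tildeR_is_unital_jordan_hom
    {A : Type*} [NormedRing A] [StarRing A] [CStarRing A] [NormedAlgebra ℂ A]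
    [CompleteSpace A] [StarModule ℂ A]
    (hrr0 : ∀ a : A, IsSelfAdjoint a → a ∈ closure {x : A | IsSelfAdjoint x ∧ IsUnit x})
    {B : Type*} [NormedRing B] [NormedAlgebra ℂ B] [CompleteSpace B]
    (T : A → B)
    (hsurj : Function.Surjective T)
    (hadd : ∀ x y : A, T (x + y) = T x + T y)
    (hspec : ∀ x : A, spectrum ℂ (T x) = spectrum ℂ x)
    (S : A →ₗ[ℂ] B) (hS1 : S 1 = 1) (hSj : ∀ x : A, S (x * x) = S x * S x)
    (hST : ∀ a : A, IsSelfAdjoint a → S a = T a)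
    (R : A → A) (hR : ∀ x : A, T (R x) = S x) :
    (∀ x y : A,
        ((1 : ℂ) / 2) • (R (x + y) - Complex.I • R (Complex.I • (x + y))) =
          ((1 : ℂ) / 2) • (R x - Complex.I • R (Complex.I • x)) +
            ((1 : ℂ) / 2) • (R y - Complex.I • R (Complex.I • y))) ∧
      (∀ (c : ℂ) (x : A),
        ((1 : ℂ) / 2) • (R (c • x) - Complex.I • R (Complex.I • (c • x))) =
          c • (((1 : ℂ) / 2) • (R x - Complex.I • R (Complex.I • x)))) ∧
      ((1 : ℂ) / 2) • (R 1 - Complex.I • R (Complex.I • (1 : A))) = 1 ∧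
      ∀ x : A,
        ((1 : ℂ) / 2) • (R (x * x) - Complex.I • R (Complex.I • (x * x))) =
          (((1 : ℂ) / 2) • (R x - Complex.I • R (Complex.I • x))) *
            (((1 : ℂ) / 2) • (R x - Complex.I • R (Complex.I • x))) := by
  let _ : CStarAlgebra A := { }
  let _ : PartialOrder A := CStarAlgebra.spectralOrder A
  have : StarOrderedRing A := CStarAlgebra.spectralOrderedRing A
  have hRid : ∀ x : A, R x = x := by
    intro x
    refine eq_of_forall_spectrum_add_subset hrr0 fun a ha => ?_
    rw [← hspec, hadd, hR, ← hST a ha, ← map_add]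
    exact jordanHom_spectrum_subset hS1 hSj _
  have hid : ∀ x : A, ((1 : ℂ) / 2) • (x - Complex.I • Complex.I • x) = x := by
    intro x
    rw [smul_smul, Complex.I_mul_I]
    module
  simp only [hRid, hid, implies_true, and_self]
end
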